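/- arXiv:2403.07298 — 2 statements merged into one kernel-verified Lean document; each statement's English description precedes it below -/
import Mathlib

section
/- For |a| < 1, ∫₀¹ K(2√(x(1-x))) / √(1 - 2(2x-1)a + a²) dx = (π²/4)[1 + Σ_{n≥1} (-1)^n ((1/2)_n³/(1)_n³) a^{2n}]. -/
open MeasureTheory Real Filter

/-- Pochhammer symbol `(x)_n`. -/
noncomputable def poch (x : ℝ) (n : ℕ) : ℝ := ∏ i ∈ Finset.range n, (x + i)

/-- Complete elliptic integral of the first kind. -/
noncomputable def K (k : ℝ) : ℝ :=
  ∫ θ in Set.Ioo 0 (Real.pi / 2), 1 / Real.sqrt (1 - k ^ 2 * Real.sin θ ^ 2)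

/-- `K` as a function of the squared modulus, via the hypergeometric series
`K(k) = (π/2) ₂F₁(1/2,1/2;1;k²)`. -/
noncomputable def Ksq (m : ℝ) : ℝ :=
  (Real.pi / 2) * ∑' n : ℕ, poch (1/2) n ^ 2 / poch 1 n ^ 2 * m ^ n

/-- Legendre polynomial `P_n(x)`. -/
noncomputable def P (n : ℕ) (x : ℝ) : ℝ :=
  (1 / 2 ^ n) * ∑ k ∈ Finset.range (n + 1), (n.choose k : ℝ) ^ 2 * (x - 1) ^ (n - k) * (x + 1) ^ k

lemma poch_succ (x : ℝ) (n : ℕ) : poch x (n + 1) = poch x n * (x + n) :=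
  Finset.prod_range_succ _ _

lemma poch_zero (x : ℝ) : poch x 0 = 1 := Finset.prod_range_zero _

lemma poch_pos {x : ℝ} (hx : 0 < x) (n : ℕ) : 0 < poch x n :=
  Finset.prod_pos fun i _ => by positivity

/-- The coefficient `(1/2)_n / (1)_n` of `x ^ n` in `(1 - x) ^ (-1/2)`. -/
noncomputable def halfCoeff (n : ℕ) : ℝ := poch (1 / 2) n / poch 1 n

lemma halfCoeff_zero : halfCoeff 0 = 1 := by simp [halfCoeff, poch_zero]

lemma halfCoeff_pos (n : ℕ) : 0 < halfCoeff n :=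
  div_pos (poch_pos (by norm_num) n) (poch_pos one_pos n)

lemma halfCoeff_succ (n : ℕ) : (n + 1) * halfCoeff (n + 1) = (n + 1 / 2) * halfCoeff n := by
  have h := (poch_pos one_pos n).ne'
  have h' : (1 + n : ℝ) ≠ 0 := by positivity
  simp only [halfCoeff, poch_succ]
  field_simp
  ring

lemma choose_succ_mul_sub (n k : ℕ) :
    ((n + 1).choose k : ℝ) * (n + 1 - k) = (n + 1) * n.choose k := by
  rcases le_or_gt k (n + 1) with h | h
  · have := Nat.choose_mul_succ_eq n k
    have e : ((n + 1 - k : ℕ) : ℝ) = n + 1 - k := by push_cast [Nat.cast_sub h]; ring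
    rw [← e]
    have := congrArg (Nat.cast : ℕ → ℝ) this
    push_cast at this
    linarith
  · rw [Nat.choose_eq_zero_of_lt h, Nat.choose_eq_zero_of_lt (by omega)]; simp

lemma choose_succ_right_mul (n k : ℕ) :
    (n.choose (k + 1) : ℝ) * (k + 1) = n.choose k * (n - k) := by
  rcases le_or_gt k n with h | h
  · have := congrArg (Nat.cast : ℕ → ℝ) (Nat.choose_succ_right_eq n k)
    push_cast [Nat.cast_sub h] at this
    exact this
  · rw [Nat.choose_eq_zero_of_lt h, Nat.choose_eq_zero_of_lt (by omega)]; simp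

/-- The term of the Saalschützian sum `₃F₂(-n, n + 1/2, 1/2; 1, 1; 1)`. -/
noncomputable def saalschutzTerm (n k : ℕ) : ℝ :=
  (-1) ^ k * n.choose k * poch (1 / 2) (n + k) * poch (1 / 2) k / (poch (1 / 2) n * poch 1 k ^ 2)

/-- The telescoped form of the recurrence in `n` satisfied by `saalschutzTerm`. -/
lemma sum_saalschutzTerm_succ_sub (n m : ℕ) :
    ∑ k ∈ Finset.range m, ((n + 1) ^ 2 * saalschutzTerm (n + 1) k
        - (n + 1 / 2) ^ 2 * saalschutzTerm n k) =
      -(2 * n + 3 / 2) * m ^ 3 * ((-1) ^ m * (n + 1).choose m * poch (1 / 2) (n + m)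
        * poch (1 / 2) m) / ((n + 1 / 2) * (n + 1) * poch (1 / 2) n * poch 1 m ^ 2) := by
  induction m with
  | zero => simp
  | succ k ih =>
    rw [Finset.sum_range_succ, ih]
    have hn : (n + 1 / 2 : ℝ) ≠ 0 := by positivity
    have hn' : (1 / 2 + n : ℝ) ≠ 0 := by positivity
    have hn1 : (n + 1 : ℝ) ≠ 0 := by positivity
    have hk1 : (1 + k : ℝ) ≠ 0 := by positivity
    have h1 := (poch_pos (x := 1 / 2) (by norm_num) n).ne'
    have h2 := (poch_pos one_pos k).ne'
    have e1 : (n.choose k : ℝ) = (n + 1).choose k * (n + 1 - k) / (n + 1) := by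
      rw [choose_succ_mul_sub]; field_simp
    have e2 : ((n + 1).choose (k + 1) : ℝ) = (n + 1).choose k * (n + 1 - k) / (1 + k) := by
      have := choose_succ_right_mul (n + 1) k
      push_cast at this
      rw [← this]; field_simp; ring
    simp only [saalschutzTerm, e1, e2, show n + 1 + k = n + k + 1 by ring,
      show n + (k + 1) = n + k + 1 by ring, poch_succ]
    push_cast
    have hk : (k + 1 / 2 : ℝ) ≠ 0 := by positivity
    field_simp
    ring

lemma sum_saalschutzTerm (n : ℕ) :
    ∑ k ∈ Finset.range (n + 1), saalschutzTerm n k = halfCoeff n ^ 2 := by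
  induction n with
  | zero => simp [saalschutzTerm, halfCoeff, poch_zero]
  | succ n ih =>
    have h := sum_saalschutzTerm_succ_sub n (n + 2)
    rw [Nat.choose_eq_zero_of_lt (by omega : n + 1 < n + 2), Finset.sum_sub_distrib,
      ← Finset.mul_sum, ← Finset.mul_sum, Finset.sum_range_succ (saalschutzTerm n), ih] at h
    have h0 : saalschutzTerm n (n + 1) = 0 := by simp [saalschutzTerm]
    rw [h0] at h
    have hs := halfCoeff_succ n
    have hn : (n + 1 : ℝ) ^ 2 ≠ 0 := by positivity
    apply mul_left_cancel₀ hn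
    simp only [Nat.cast_zero, mul_zero, zero_mul, zero_div, add_zero] at h
    rw [← mul_pow, hs, mul_pow]
    linarith

/-- Coefficient of `u ^ (2 * k)` in the Legendre polynomial of degree `2 * n`. -/
noncomputable def legendreEvenCoeff (n k : ℕ) : ℝ :=
  (-1) ^ (n + k) * n.choose k * poch (1 / 2) (n + k) / (poch 1 n * poch (1 / 2) k)

/-- Coefficient of `u ^ (2 * k + 1)` in the Legendre polynomial of degree `2 * n + 1`. -/
noncomputable def legendreOddCoeff (n k : ℕ) : ℝ :=
  (-1) ^ (n + k) * n.choose k * poch (1 / 2) (n + k + 1) / (poch 1 n * poch (1 / 2) (k + 1))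

lemma sum_legendreEvenCoeff_mul_sq (n : ℕ) :
    ∑ k ∈ Finset.range (n + 1), legendreEvenCoeff n k * halfCoeff k ^ 2 =
      (-1) ^ n * halfCoeff n ^ 3 := by
  have : ∀ k, legendreEvenCoeff n k * halfCoeff k ^ 2
      = (-1) ^ n * halfCoeff n * saalschutzTerm n k := fun k => by
    have h1 := (poch_pos (x := 1 / 2) (by norm_num) n).ne'
    have h2 := (poch_pos (x := 1 / 2) (by norm_num) k).ne'
    have h3 := (poch_pos one_pos n).ne'
    have h4 := (poch_pos one_pos k).ne'
    simp only [legendreEvenCoeff, saalschutzTerm, halfCoeff]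
    field_simp
    ring
  simp only [this, ← Finset.mul_sum, sum_saalschutzTerm]
  ring

lemma legendreOddCoeff_recurrence (n k : ℕ) :
    (2 * n + 3) * legendreOddCoeff (n + 1) k =
      (4 * n + 5) * legendreEvenCoeff (n + 1) k - (2 * n + 2) * legendreOddCoeff n k := by
  have hk : (1 / 2 + k : ℝ) ≠ 0 := by positivity
  have hn1 : (1 + n : ℝ) ≠ 0 := by positivity
  have h2 := (poch_pos (x := 1 / 2) (by norm_num) k).ne'
  have h3 := (poch_pos one_pos n).ne'
  have e1 : (n.choose k : ℝ) = (n + 1).choose k * (n + 1 - k) / (1 + n) := by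
    rw [choose_succ_mul_sub]; field_simp; ring
  simp only [legendreOddCoeff, legendreEvenCoeff, e1, show n + 1 + k = n + k + 1 by ring, poch_succ]
  push_cast
  field_simp
  ring

lemma legendreEvenCoeff_recurrence_zero (n : ℕ) :
    (2 * n + 2) * legendreEvenCoeff (n + 1) 0 = -(2 * n + 1) * legendreEvenCoeff n 0 := by
  have hn1 : (1 + n : ℝ) ≠ 0 := by positivity
  have h3 := (poch_pos one_pos n).ne'
  simp only [legendreEvenCoeff, poch_succ, poch_zero, Nat.choose_zero_right, add_zero]
  field_simp
  ring

lemma legendreEvenCoeff_recurrence_succ (n k : ℕ) :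
    (2 * n + 2) * legendreEvenCoeff (n + 1) (k + 1) =
      (4 * n + 3) * legendreOddCoeff n k - (2 * n + 1) * legendreEvenCoeff n (k + 1) := by
  have hk : (1 / 2 + k : ℝ) ≠ 0 := by positivity
  have hk1 : (k + 1 : ℝ) ≠ 0 := by positivity
  have hn1 : (1 + n : ℝ) ≠ 0 := by positivity
  have h2 := (poch_pos (x := 1 / 2) (by norm_num) k).ne'
  have h3 := (poch_pos one_pos n).ne'
  have e1 : (n.choose (k + 1) : ℝ) = n.choose k * (n - k) / (k + 1) := by
    rw [← choose_succ_right_mul]; field_simp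
  have e2 : ((n + 1).choose (k + 1) : ℝ) = n.choose k * (n + 1) / (k + 1) := by
    rw [Nat.choose_succ_succ]; push_cast; rw [e1]; field_simp; ring
  simp only [legendreOddCoeff, legendreEvenCoeff, e1, e2,
    show n + 1 + (k + 1) = n + k + 1 + 1 by ring, show n + (k + 1) = n + k + 1 by ring, poch_succ]
  push_cast
  field_simp
  ring

/-- The homogeneous Legendre polynomial `∑ c_j c_k z ^ j w ^ k` over `j + k = n`. -/
noncomputable def legendreHom (n : ℕ) (z w : ℂ) : ℂ :=
  ∑ p ∈ Finset.HasAntidiagonal.antidiagonal n, (halfCoeff p.1 * z ^ p.1) * (halfCoeff p.2 * w ^ p.2)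

lemma legendreHom_recurrence (n : ℕ) (z w : ℂ) :
    (n + 2) * legendreHom (n + 2) z w =
      (n + 3 / 2) * (z + w) * legendreHom (n + 1) z w - (n + 1) * (z * w) * legendreHom n z w := by
  set A : ℕ → ℂ := fun n => ∑ p ∈ Finset.HasAntidiagonal.antidiagonal n,
    p.1 * ((halfCoeff p.1 * z ^ p.1) * (halfCoeff p.2 * w ^ p.2)) with hA
  set B : ℕ → ℂ := fun n => ∑ p ∈ Finset.HasAntidiagonal.antidiagonal n,
    p.2 * ((halfCoeff p.1 * z ^ p.1) * (halfCoeff p.2 * w ^ p.2)) with hB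
  have hc : ∀ n : ℕ, ((n : ℂ) + 1) * halfCoeff (n + 1) = (n + 1 / 2) * halfCoeff n := fun n => by
    have h := congrArg Complex.ofReal (halfCoeff_succ n)
    push_cast at h
    exact h
  have hAB : ∀ n, A n + B n = n * legendreHom n z w := fun n => by
    simp only [hA, hB, legendreHom, Finset.mul_sum, ← Finset.sum_add_distrib]
    refine Finset.sum_congr rfl fun p hp => ?_
    rw [← Finset.HasAntidiagonal.mem_antidiagonal.1 hp]; push_cast; ring
  have hA' : ∀ n, A (n + 1) = z * (A n + legendreHom n z w / 2) := fun n => by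
    simp only [hA, legendreHom, Finset.Nat.sum_antidiagonal_succ, Finset.sum_div,
      ← Finset.sum_add_distrib, Finset.mul_sum]
    simp only [Nat.cast_zero, zero_mul, zero_add]
    refine Finset.sum_congr rfl fun p _ => ?_
    push_cast
    linear_combination z ^ (p.1 + 1) * (halfCoeff p.2 * w ^ p.2) * hc p.1
  have hB' : ∀ n, B (n + 1) = w * (B n + legendreHom n z w / 2) := fun n => by
    simp only [hB, legendreHom, Finset.Nat.sum_antidiagonal_succ', Finset.sum_div,
      ← Finset.sum_add_distrib, Finset.mul_sum]
    simp only [Nat.cast_zero, zero_mul, zero_add]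
    refine Finset.sum_congr rfl fun p _ => ?_
    push_cast
    linear_combination w ^ (p.2 + 1) * (halfCoeff p.1 * z ^ p.1) * hc p.2
  have h2 := hAB (n + 2)
  have h1 := hAB (n + 1)
  have h0 := hAB n
  have a2 := hA' (n + 1)
  have b2 := hB' (n + 1)
  have a1 := hA' n
  have b1 := hB' n
  push_cast at h2 h1
  linear_combination -h2 + a2 + b2 + (z + w) * h1 - w * a1 - z * b1 - z * w * h0

lemma legendreHom_zero (z w : ℂ) : legendreHom 0 z w = 1 := by
  simp [legendreHom, halfCoeff_zero]

lemma legendreHom_one (z w : ℂ) : legendreHom 1 z w = (z + w) / 2 := by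
  have h := halfCoeff_succ 0
  have h' : halfCoeff 1 = 1 / 2 := by simpa [halfCoeff_zero] using h
  simp [legendreHom, Finset.Nat.sum_antidiagonal_succ, halfCoeff_zero, h']
  ring

lemma legendreHom_one_one (n : ℕ) : legendreHom n 1 1 = 1 := by
  induction n using Nat.twoStepInduction with
  | zero => exact legendreHom_zero _ _
  | one => rw [legendreHom_one]; norm_num
  | more n h0 h1 =>
    have h := legendreHom_recurrence n 1 1
    rw [h0, h1] at h
    have hn : (n + 2 : ℂ) ≠ 0 := by exact_mod_cast (by omega : n + 2 ≠ 0)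
    apply mul_left_cancel₀ hn
    rw [h]; ring

lemma sum_halfCoeff_mul_halfCoeff (n : ℕ) :
    ∑ p ∈ Finset.HasAntidiagonal.antidiagonal n, halfCoeff p.1 * halfCoeff p.2 = 1 := by
  have := legendreHom_one_one n
  simp only [legendreHom, one_pow, mul_one] at this
  exact_mod_cast this

lemma norm_legendreHom_le (n : ℕ) {z w : ℂ} (hz : ‖z‖ = 1) (hw : ‖w‖ = 1) :
    ‖legendreHom n z w‖ ≤ 1 := by
  rw [← sum_halfCoeff_mul_halfCoeff n]
  refine (norm_sum_le _ _).trans (Finset.sum_le_sum fun p _ => ?_)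
  simp [hz, hw, abs_of_pos (halfCoeff_pos _)]

/-- The Legendre polynomial of degree `2 * n`, as an explicit sum. -/
noncomputable def legendreEven (n : ℕ) (u : ℝ) : ℝ :=
  ∑ k ∈ Finset.range (n + 1), legendreEvenCoeff n k * u ^ (2 * k)

/-- The Legendre polynomial of degree `2 * n + 1`, as an explicit sum. -/
noncomputable def legendreOdd (n : ℕ) (u : ℝ) : ℝ :=
  ∑ k ∈ Finset.range (n + 1), legendreOddCoeff n k * u ^ (2 * k + 1)

lemma legendreEven_eq_sum (n : ℕ) (u : ℝ) :
    legendreEven n u = ∑ k ∈ Finset.range (n + 2), legendreEvenCoeff n k * u ^ (2 * k) := by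
  rw [Finset.sum_range_succ, legendreEven, legendreEvenCoeff, Nat.choose_succ_self]
  simp

lemma legendreOdd_eq_sum (n : ℕ) (u : ℝ) :
    legendreOdd n u = ∑ k ∈ Finset.range (n + 2), legendreOddCoeff n k * u ^ (2 * k + 1) := by
  rw [Finset.sum_range_succ, legendreOdd, legendreOddCoeff, Nat.choose_succ_self]
  simp

lemma legendreEven_recurrence (n : ℕ) (u : ℝ) :
    (2 * n + 2) * legendreEven (n + 1) u =
      (4 * n + 3) * u * legendreOdd n u - (2 * n + 1) * legendreEven n u := by
  rw [legendreEven_eq_sum n, legendreEven, legendreOdd, Finset.sum_range_succ' _ (n + 1),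
    Finset.sum_range_succ' _ (n + 1), mul_add, mul_add, Finset.mul_sum, Finset.mul_sum,
    Finset.mul_sum]
  have h : ∀ k, (2 * n + 2) * (legendreEvenCoeff (n + 1) (k + 1) * u ^ (2 * (k + 1)))
      = (4 * n + 3) * u * (legendreOddCoeff n k * u ^ (2 * k + 1))
        - (2 * n + 1) * (legendreEvenCoeff n (k + 1) * u ^ (2 * (k + 1))) := fun k => by
    linear_combination u ^ (2 * k + 2) * legendreEvenCoeff_recurrence_succ n k
  simp only [h, Finset.sum_sub_distrib]
  linear_combination u ^ 0 * legendreEvenCoeff_recurrence_zero n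

lemma legendreOdd_recurrence (n : ℕ) (u : ℝ) :
    (2 * n + 3) * legendreOdd (n + 1) u =
      (4 * n + 5) * u * legendreEven (n + 1) u - (2 * n + 2) * legendreOdd n u := by
  rw [legendreOdd_eq_sum n, legendreOdd, legendreEven, Finset.mul_sum, Finset.mul_sum,
    Finset.mul_sum, ← Finset.sum_sub_distrib]
  refine Finset.sum_congr rfl fun k _ => ?_
  linear_combination u ^ (2 * k + 1) * legendreOddCoeff_recurrence n k

lemma legendreHom_eq {z w : ℂ} {u : ℝ} (hzw : z * w = 1) (hu : z + w = 2 * u) (n : ℕ) :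
    legendreHom (2 * n) z w = legendreEven n u ∧
      legendreHom (2 * n + 1) z w = legendreOdd n u := by
  induction n with
  | zero =>
    refine ⟨?_, ?_⟩
    · simp [legendreHom_zero, legendreEven, legendreEvenCoeff, poch_zero]
    · have : poch 2⁻¹ 1 ≠ 0 := (poch_pos (by norm_num) 1).ne'
      simp only [mul_zero, zero_add, legendreHom_one, hu, legendreOdd, legendreOddCoeff]
      simp [poch_zero, this]
  | succ n ih =>
    have h1 := legendreHom_recurrence (2 * n) z w
    have h2 := legendreHom_recurrence (2 * n + 1) z w
    have e1 := congrArg Complex.ofReal (legendreEven_recurrence n u)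
    have e2 := congrArg Complex.ofReal (legendreOdd_recurrence n u)
    rw [hzw, hu, ih.1, ih.2] at h1
    rw [hzw, hu, ih.2] at h2
    push_cast at h1 h2 e1 e2
    have hn : (2 * n + 2 : ℂ) ≠ 0 := by exact_mod_cast (by omega : 2 * n + 2 ≠ 0)
    have hn' : (2 * n + 3 : ℂ) ≠ 0 := by exact_mod_cast (by omega : 2 * n + 3 ≠ 0)
    have hE : legendreHom (2 * n + 2) z w = legendreEven (n + 1) u := by
      apply mul_left_cancel₀ hn
      linear_combination h1 - e1
    refine ⟨hE, ?_⟩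
    apply mul_left_cancel₀ hn'
    rw [hE] at h2
    rw [show 2 * (n + 1) + 1 = 2 * n + 1 + 2 by ring]
    linear_combination h2 - e2

lemma halfCoeff_le_one (n : ℕ) : halfCoeff n ≤ 1 := by
  rw [← sum_halfCoeff_mul_halfCoeff n]
  have := Finset.single_le_sum (f := fun p : ℕ × ℕ => halfCoeff p.1 * halfCoeff p.2)
    (fun p _ => (mul_pos (halfCoeff_pos _) (halfCoeff_pos _)).le)
    (Finset.HasAntidiagonal.mem_antidiagonal.2 (show (n, 0).1 + (n, 0).2 = n from add_zero n))
  simpa [halfCoeff_zero] using this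

lemma summable_norm_halfCoeff_mul_pow {w : ℂ} (hw : ‖w‖ < 1) :
    Summable fun n : ℕ => ‖(halfCoeff n : ℂ) * w ^ n‖ := by
  refine (summable_geometric_of_lt_one (norm_nonneg w) hw).of_nonneg_of_le
    (fun _ => norm_nonneg _) fun n => ?_
  rw [norm_mul, norm_pow, Complex.norm_real, Real.norm_of_nonneg (halfCoeff_pos n).le]
  exact mul_le_of_le_one_left (by positivity) (halfCoeff_le_one n)

lemma tsum_halfCoeff_sq {w : ℂ} (hw : ‖w‖ < 1) :
    (∑' n : ℕ, (halfCoeff n : ℂ) * w ^ n) ^ 2 = (1 - w)⁻¹ := by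
  rw [sq, tsum_mul_tsum_eq_tsum_sum_antidiagonal_of_summable_norm
    (summable_norm_halfCoeff_mul_pow hw) (summable_norm_halfCoeff_mul_pow hw),
    ← tsum_geometric_of_norm_lt_one hw]
  refine tsum_congr fun n => ?_
  have h : ∀ p ∈ Finset.HasAntidiagonal.antidiagonal n,
      (halfCoeff p.1 : ℂ) * w ^ p.1 * (halfCoeff p.2 * w ^ p.2)
        = ((halfCoeff p.1 * halfCoeff p.2 : ℝ) : ℂ) * w ^ n := fun p hp => by
    rw [← Finset.HasAntidiagonal.mem_antidiagonal.1 hp]; push_cast; ring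
  rw [Finset.sum_congr rfl h, ← Finset.sum_mul, ← Complex.ofReal_sum,
    sum_halfCoeff_mul_halfCoeff]
  simp

lemma legendreHom_smul (a : ℂ) (n : ℕ) (z w : ℂ) :
    legendreHom n (a * z) (a * w) = a ^ n * legendreHom n z w := by
  simp only [legendreHom, Finset.mul_sum]
  refine Finset.sum_congr rfl fun p hp => ?_
  rw [← Finset.HasAntidiagonal.mem_antidiagonal.1 hp]; ring

lemma hasSum_legendreHom {z w : ℂ} (hz : ‖z‖ < 1) (hw : ‖w‖ < 1) :
    HasSum (fun n => legendreHom n z w)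
      ((∑' n : ℕ, (halfCoeff n : ℂ) * z ^ n) * ∑' n : ℕ, (halfCoeff n : ℂ) * w ^ n) := by
  have hs := summable_norm_sum_mul_antidiagonal_of_summable_norm
    (summable_norm_halfCoeff_mul_pow hz) (summable_norm_halfCoeff_mul_pow hw)
  rw [tsum_mul_tsum_eq_tsum_sum_antidiagonal_of_summable_norm
    (summable_norm_halfCoeff_mul_pow hz) (summable_norm_halfCoeff_mul_pow hw)]
  exact hs.of_norm.hasSum

/-- The Legendre polynomial of degree `n` on `[-1, 1]`, in trigonometric form. -/
noncomputable def legendre (n : ℕ) (u : ℝ) : ℝ :=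
  (legendreHom n ⟨u, √(1 - u ^ 2)⟩ ⟨u, -√(1 - u ^ 2)⟩).re

lemma continuous_legendre (n : ℕ) : Continuous (legendre n) := by
  have h1 : Continuous fun u : ℝ => (⟨u, √(1 - u ^ 2)⟩ : ℂ) := by
    have : (fun u : ℝ => (⟨u, √(1 - u ^ 2)⟩ : ℂ)) = fun u : ℝ => u + √(1 - u ^ 2) * Complex.I := by
      ext u; exact Complex.mk_eq_add_mul_I _ _
    rw [this]; fun_prop
  have h2 : Continuous fun u : ℝ => (⟨u, -√(1 - u ^ 2)⟩ : ℂ) :=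
    Complex.continuous_conj.comp h1
  unfold legendre legendreHom
  fun_prop

section

variable {u : ℝ}

lemma unit_mul_conj (hu : |u| ≤ 1) :
    (⟨u, √(1 - u ^ 2)⟩ : ℂ) * ⟨u, -√(1 - u ^ 2)⟩ = 1 := by
  have h : 0 ≤ 1 - u ^ 2 := by nlinarith [abs_le.1 hu]
  apply Complex.ext
  · simp only [Complex.mul_re, Complex.one_re]
    nlinarith [Real.sq_sqrt h]
  · simp only [Complex.mul_im, Complex.one_im]
    ring

lemma norm_unit (hu : |u| ≤ 1) : ‖(⟨u, √(1 - u ^ 2)⟩ : ℂ)‖ = 1 := by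
  have h : 0 ≤ 1 - u ^ 2 := by nlinarith [abs_le.1 hu]
  rw [Complex.norm_def, Complex.normSq_mk, Real.sqrt_eq_one]
  nlinarith [Real.sq_sqrt h]

lemma norm_unit_conj (hu : |u| ≤ 1) : ‖(⟨u, -√(1 - u ^ 2)⟩ : ℂ)‖ = 1 :=
  (Complex.norm_conj ⟨u, √(1 - u ^ 2)⟩).trans (norm_unit hu)

lemma unit_add_conj : (⟨u, √(1 - u ^ 2)⟩ : ℂ) + ⟨u, -√(1 - u ^ 2)⟩ = 2 * u := by
  apply Complex.ext <;> simp
  ring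

lemma abs_legendre_le (hu : |u| ≤ 1) (n : ℕ) : |legendre n u| ≤ 1 :=
  (Complex.abs_re_le_norm _).trans (norm_legendreHom_le n (norm_unit hu) (norm_unit_conj hu))

lemma legendre_even (hu : |u| ≤ 1) (n : ℕ) : legendre (2 * n) u = legendreEven n u := by
  rw [legendre, (legendreHom_eq (unit_mul_conj hu) unit_add_conj n).1, Complex.ofReal_re]

lemma legendre_odd (hu : |u| ≤ 1) (n : ℕ) : legendre (2 * n + 1) u = legendreOdd n u := by
  rw [legendre, (legendreHom_eq (unit_mul_conj hu) unit_add_conj n).2, Complex.ofReal_re]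

/-- The generating function of the Legendre polynomials. -/
lemma hasSum_legendre {a : ℝ} (ha : |a| < 1) (hu : |u| ≤ 1) :
    HasSum (fun n => a ^ n * legendre n u) (1 / √(1 - 2 * u * a + a ^ 2)) := by
  set z : ℂ := ⟨u, √(1 - u ^ 2)⟩
  set w : ℂ := ⟨u, -√(1 - u ^ 2)⟩
  have hza : ‖(a : ℂ) * z‖ < 1 := by rwa [norm_mul, norm_unit hu, mul_one, Complex.norm_real]
  have hwa : ‖(a : ℂ) * w‖ < 1 := by rwa [norm_mul, norm_unit_conj hu, mul_one, Complex.norm_real]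
  set g : ℂ := ∑' n : ℕ, (halfCoeff n : ℂ) * (a * z) ^ n with hg
  have hconj : (∑' n : ℕ, (halfCoeff n : ℂ) * (a * w) ^ n) = (starRingEnd ℂ) g := by
    rw [hg, Complex.conj_tsum]
    refine tsum_congr fun n => ?_
    have : (starRingEnd ℂ) z = w := rfl
    simp [this]
  have h := hasSum_legendreHom hza hwa
  have hprod : (1 - a * z) * (1 - a * w) = ((1 - 2 * u * a + a ^ 2 : ℝ) : ℂ) := by
    push_cast
    linear_combination (a : ℂ) ^ 2 * unit_mul_conj hu - a * unit_add_conj (u := u)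
  have hsq : (Complex.normSq g) ^ 2 = (1 - 2 * u * a + a ^ 2)⁻¹ := by
    have h1 := tsum_halfCoeff_sq hza
    have h2 := tsum_halfCoeff_sq hwa
    rw [hconj] at h2
    apply Complex.ofReal_injective
    push_cast
    rw [← Complex.mul_conj, mul_pow, h1, h2, ← mul_inv, hprod]
    push_cast
    rfl
  rw [hconj, Complex.mul_conj] at h
  have h' := Complex.hasSum_re h
  rw [Complex.ofReal_re, ← Real.sqrt_sq (Complex.normSq_nonneg g), hsq, Real.sqrt_inv,
    ← one_div] at h'
  refine h'.congr_fun fun n => ?_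
  rw [legendreHom_smul, ← Complex.ofReal_pow, Complex.re_ofReal_mul]
  rfl

end

/-- The integral of `sin ^ m` over a quarter period. -/
noncomputable def wallis (m : ℕ) : ℝ := ∫ θ in Set.Ioo 0 (π / 2), sin θ ^ m

lemma lintegral_sin_pow (m : ℕ) :
    ∫⁻ θ in Set.Ioo 0 (π / 2), ENNReal.ofReal (sin θ ^ m) = ENNReal.ofReal (wallis m) := by
  rw [wallis, ofReal_integral_eq_lintegral_ofReal]
  · exact ((by fun_prop : Continuous fun θ => sin θ ^ m).integrableOn_Icc).mono_set
      Set.Ioo_subset_Icc_self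
  · filter_upwards [self_mem_ae_restrict measurableSet_Ioo] with θ hθ
    exact pow_nonneg (sin_pos_of_pos_of_lt_pi hθ.1 (by linarith [hθ.2, pi_pos])).le m

lemma wallis_nonneg (m : ℕ) : 0 ≤ wallis m :=
  setIntegral_nonneg measurableSet_Ioo fun _ hθ =>
    pow_nonneg (sin_pos_of_pos_of_lt_pi hθ.1 (by linarith [hθ.2, pi_pos])).le m

lemma wallis_even (n : ℕ) : wallis (2 * n) = π / 2 * halfCoeff n := by
  have hrefl : ∫ x in (π / 2)..π, sin x ^ (2 * n) = ∫ x in 0..(π / 2), sin x ^ (2 * n) := by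
    have := intervalIntegral.integral_comp_sub_left (fun x => sin x ^ (2 * n)) (a := 0)
      (b := π / 2) π
    simp only [sin_pi_sub, sub_zero, show π - π / 2 = π / 2 by ring] at this
    exact this.symm
  have hprod : ∏ i ∈ Finset.range n, (2 * (i : ℝ) + 1) / (2 * i + 2) = halfCoeff n := by
    rw [halfCoeff, poch, poch, ← Finset.prod_div_distrib]
    refine Finset.prod_congr rfl fun i _ => ?_
    have : (1 + i : ℝ) ≠ 0 := by positivity
    field_simp
    ring
  have h := integral_sin_pow_even n
  have hc : Continuous fun x => sin x ^ (2 * n) := by fun_prop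
  rw [hprod, ← intervalIntegral.integral_add_adjacent_intervals (b := π / 2)
    (hc.intervalIntegrable _ _) (hc.intervalIntegrable _ _), hrefl,
    intervalIntegral.integral_of_le (by positivity), integral_Ioc_eq_integral_Ioo] at h
  rw [wallis]
  linarith

lemma sin_mem_Ioo {θ : ℝ} (hθ : θ ∈ Set.Ioo 0 (π / 2)) : sin θ ∈ Set.Ioo 0 1 := by
  refine ⟨sin_pos_of_pos_of_lt_pi hθ.1 (by linarith [hθ.2, pi_pos]), ?_⟩
  rw [← sin_pi_div_two]
  exact sin_lt_sin_of_lt_of_le_pi_div_two (by linarith [hθ.1, pi_pos]) le_rfl hθ.2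

lemma cos_pos_of_mem {θ : ℝ} (hθ : θ ∈ Set.Ioo 0 (π / 2)) : 0 < cos θ :=
  cos_pos_of_mem_Ioo ⟨by linarith [hθ.1, pi_pos], hθ.2⟩

lemma injOn_sin_Ioo : Set.InjOn sin (Set.Ioo 0 (π / 2)) :=
  injOn_sin.mono (Set.Ioo_subset_Icc_self.trans
    (Set.Icc_subset_Icc_left (by linarith [pi_pos])))

lemma image_sin_Ioo : sin '' Set.Ioo 0 (π / 2) = Set.Ioo 0 1 := by
  ext s
  refine ⟨?_, fun hs => ⟨arcsin s, ⟨arcsin_pos.2 hs.1, arcsin_lt_pi_div_two.2 hs.2⟩,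
    sin_arcsin (by linarith [hs.1]) hs.2.le⟩⟩
  rintro ⟨θ, hθ, rfl⟩
  exact sin_mem_Ioo hθ

lemma lintegral_pow_div_sqrt {t : ℝ} (ht : 0 < t) (m : ℕ) :
    ∫⁻ u in Set.Ioo 0 t, ENNReal.ofReal (u ^ m / √(t ^ 2 - u ^ 2)) =
      ENNReal.ofReal (t ^ m * wallis m) := by
  have himg : (fun β => t * sin β) '' Set.Ioo 0 (π / 2) = Set.Ioo 0 t := by
    rw [show (fun β => t * sin β) = (fun s => t * s) ∘ sin from rfl, Set.image_comp,
      image_sin_Ioo, Set.image_mul_left_Ioo ht, mul_zero, mul_one]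
  rw [← himg, lintegral_image_eq_lintegral_abs_deriv_mul measurableSet_Ioo
    (fun β _ => ((hasDerivAt_sin β).const_mul t).hasDerivWithinAt)
    (fun x hx y hy h => injOn_sin_Ioo hx hy (mul_left_cancel₀ ht.ne' h)),
    ENNReal.ofReal_mul (by positivity), ← lintegral_sin_pow,
    ← lintegral_const_mul _ (by fun_prop)]
  refine setLIntegral_congr_fun measurableSet_Ioo fun β hβ => ?_
  have hc := cos_pos_of_mem hβ
  have hsqrt : √(t ^ 2 - (t * sin β) ^ 2) = t * cos β := by
    rw [show t ^ 2 - (t * sin β) ^ 2 = (t * cos β) ^ 2 by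
      linear_combination -t ^ 2 * sin_sq_add_cos_sq β, Real.sqrt_sq (by positivity)]
  rw [hsqrt, ← ENNReal.ofReal_mul (abs_nonneg _), ← ENNReal.ofReal_mul (by positivity),
    abs_of_pos (by positivity)]
  congr 1
  field_simp
  exact mul_pow _ _ _

/-- The substitution `t = √(1 - (1 - u ^ 2) sin² θ)` in the complementary integral. -/
lemma lintegral_complementary_kernel {u : ℝ} (hu : u ∈ Set.Ioo 0 1) :
    ∫⁻ θ in Set.Ioo 0 (π / 2), ENNReal.ofReal (1 / √(1 - (1 - u ^ 2) * sin θ ^ 2)) =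
      ∫⁻ t in Set.Ioo u 1, ENNReal.ofReal (1 / (√(1 - t ^ 2) * √(t ^ 2 - u ^ 2))) := by
  obtain ⟨hu0, hu1⟩ := hu
  have hq : 0 < 1 - u ^ 2 := by nlinarith
  set τ : ℝ → ℝ := fun θ => √(1 - (1 - u ^ 2) * sin θ ^ 2) with hτ
  have hpos : ∀ θ, 0 < 1 - (1 - u ^ 2) * sin θ ^ 2 := fun θ => by
    nlinarith [sin_sq_le_one θ, sq_nonneg (sin θ), mul_nonneg hq.le (sub_nonneg.2 (sin_sq_le_one θ)),
      pow_pos hu0 2]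
  have hτsq : ∀ θ, τ θ ^ 2 = 1 - (1 - u ^ 2) * sin θ ^ 2 := fun θ => Real.sq_sqrt (hpos θ).le
  have hτpos : ∀ θ, 0 < τ θ := fun θ => Real.sqrt_pos.2 (hpos θ)
  have himg : τ '' Set.Ioo 0 (π / 2) = Set.Ioo u 1 := by
    ext t
    constructor
    · rintro ⟨θ, hθ, rfl⟩
      have hs := sin_mem_Ioo hθ
      have h1 : sin θ ^ 2 < 1 := by nlinarith [hs.1, hs.2]
      have h2 : 0 < sin θ ^ 2 := pow_pos hs.1 2
      exact ⟨lt_of_pow_lt_pow_left₀ 2 (hτpos θ).le (by rw [hτsq]; nlinarith),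
        lt_of_pow_lt_pow_left₀ 2 zero_le_one (by rw [hτsq]; nlinarith)⟩
    · rintro ⟨h1, h2⟩
      have hlt : t ^ 2 < 1 := by nlinarith
      have hgt : u ^ 2 < t ^ 2 := by nlinarith
      have hr0 : 0 < (1 - t ^ 2) / (1 - u ^ 2) := div_pos (by linarith) hq
      have hr1 : (1 - t ^ 2) / (1 - u ^ 2) < 1 := (div_lt_one hq).2 (by linarith)
      have hmem : √((1 - t ^ 2) / (1 - u ^ 2)) ∈ Set.Ioo 0 1 :=
        ⟨Real.sqrt_pos.2 hr0, (Real.sqrt_lt' one_pos).2 (by simpa using hr1)⟩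
      rw [← image_sin_Ioo] at hmem
      obtain ⟨θ, hθ, h⟩ := hmem
      refine ⟨θ, hθ, ?_⟩
      simp only [hτ]
      rw [h, Real.sq_sqrt hr0.le, mul_div_cancel₀ _ hq.ne', sub_sub_cancel,
        Real.sqrt_sq (by linarith)]
  have hinj : Set.InjOn τ (Set.Ioo 0 (π / 2)) := fun x hx y hy h => by
    have h' := congrArg (· ^ 2) h
    simp only [hτsq] at h'
    have h2 : sin x ^ 2 = sin y ^ 2 := mul_left_cancel₀ hq.ne' (by linarith)
    exact injOn_sin_Ioo hx hy
      ((pow_left_inj₀ (sin_mem_Ioo hx).1.le (sin_mem_Ioo hy).1.le two_ne_zero).1 h2)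
  have hderiv : ∀ θ, HasDerivAt τ (-((1 - u ^ 2) * sin θ * cos θ / τ θ)) θ := fun θ => by
    have h := ((((hasDerivAt_sin θ).pow 2).const_mul (1 - u ^ 2)).const_sub 1).sqrt (hpos θ).ne'
    refine h.congr_deriv ?_
    change _ / (2 * τ θ) = _
    have := (hτpos θ).ne'
    field_simp
    simp
    ring
  rw [← himg, lintegral_image_eq_lintegral_abs_deriv_mul measurableSet_Ioo
    (fun θ _ => (hderiv θ).hasDerivWithinAt) hinj]
  refine setLIntegral_congr_fun measurableSet_Ioo fun θ hθ => ?_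
  have hs := (sin_mem_Ioo hθ).1
  have hc := cos_pos_of_mem hθ
  have ht := hτpos θ
  have e1 : √(1 - τ θ ^ 2) = √(1 - u ^ 2) * sin θ := by
    rw [hτsq, sub_sub_cancel, Real.sqrt_mul hq.le, Real.sqrt_sq hs.le]
  have e2 : √(τ θ ^ 2 - u ^ 2) = √(1 - u ^ 2) * cos θ := by
    rw [hτsq, show 1 - (1 - u ^ 2) * sin θ ^ 2 - u ^ 2 = (1 - u ^ 2) * cos θ ^ 2 by
      linear_combination (u ^ 2 - 1) * sin_sq_add_cos_sq θ, Real.sqrt_mul hq.le, Real.sqrt_sq hc.le]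
  rw [← ENNReal.ofReal_mul (abs_nonneg _), abs_neg, abs_of_pos (by positivity), e1, e2]
  congr 1
  have hq' : √(1 - u ^ 2) ^ 2 = 1 - u ^ 2 := Real.sq_sqrt hq.le
  have hq2 : 0 < √(1 - u ^ 2) := Real.sqrt_pos.2 hq
  change 1 / τ θ = _
  field_simp
  rw [hq']

lemma lintegral_pow_mul_complementary_kernel (m : ℕ) :
    ∫⁻ u in Set.Ioo (0 : ℝ) 1, ∫⁻ θ in Set.Ioo 0 (π / 2),
        ENNReal.ofReal (u ^ m * (1 / √(1 - (1 - u ^ 2) * sin θ ^ 2))) =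
      ENNReal.ofReal (wallis m ^ 2) := by
  set G : ℝ → ℝ → ENNReal := fun u t => (Set.Ioi u).indicator
    (fun t => ENNReal.ofReal (u ^ m / (√(1 - t ^ 2) * √(t ^ 2 - u ^ 2)))) t with hG
  have hGm : Measurable (Function.uncurry G) := by
    have : Function.uncurry G = Set.indicator {p : ℝ × ℝ | p.1 < p.2}
        (fun p => ENNReal.ofReal (p.1 ^ m / (√(1 - p.2 ^ 2) * √(p.2 ^ 2 - p.1 ^ 2)))) := by
      ext ⟨u, t⟩
      simp [hG, Set.indicator]
    rw [this]
    exact Measurable.indicator (by fun_prop) (measurableSet_lt measurable_fst measurable_snd)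
  have h1 : ∀ u ∈ Set.Ioo (0 : ℝ) 1, ∫⁻ θ in Set.Ioo 0 (π / 2),
      ENNReal.ofReal (u ^ m * (1 / √(1 - (1 - u ^ 2) * sin θ ^ 2))) =
        ∫⁻ t in Set.Ioo (0 : ℝ) 1, G u t := fun u hu => by
    have hum : 0 ≤ u ^ m := pow_nonneg hu.1.le m
    simp only [ENNReal.ofReal_mul hum]
    rw [lintegral_const_mul _ (by fun_prop), lintegral_complementary_kernel hu,
      ← lintegral_const_mul _ (by fun_prop), setLIntegral_indicator measurableSet_Ioi,
      show Set.Ioi u ∩ Set.Ioo 0 1 = Set.Ioo u 1 by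
        ext t; simp only [Set.mem_inter_iff, Set.mem_Ioi, Set.mem_Ioo]
        exact ⟨fun h => ⟨h.1, h.2.2⟩, fun h => ⟨h.1, hu.1.trans h.1, h.2⟩⟩]
    refine lintegral_congr fun t => ?_
    rw [← ENNReal.ofReal_mul hum, mul_one_div]
  have h2 : ∀ t ∈ Set.Ioo (0 : ℝ) 1, ∫⁻ u in Set.Ioo (0 : ℝ) 1, G u t =
      ENNReal.ofReal (t ^ m / √(1 ^ 2 - t ^ 2)) * ENNReal.ofReal (wallis m) := fun t ht => by
    have e : ∀ u, G u t = (Set.Iio t).indicator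
        (fun u => ENNReal.ofReal (1 / √(1 - t ^ 2)) *
          ENNReal.ofReal (u ^ m / √(t ^ 2 - u ^ 2))) u := fun u => by
      simp only [hG, Set.indicator, Set.mem_Ioi, Set.mem_Iio]
      split_ifs
      · rw [← ENNReal.ofReal_mul (by positivity)]
        congr 1
        rw [div_mul_div_comm, one_mul]
      · rfl
    simp only [e]
    rw [setLIntegral_indicator measurableSet_Iio,
      show Set.Iio t ∩ Set.Ioo 0 1 = Set.Ioo 0 t by
        ext u; simp only [Set.mem_inter_iff, Set.mem_Iio, Set.mem_Ioo]
        exact ⟨fun h => ⟨h.2.1, h.1⟩, fun h => ⟨h.2, h.1, h.2.trans ht.2⟩⟩,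
      lintegral_const_mul _ (by fun_prop), lintegral_pow_div_sqrt ht.1,
      ← ENNReal.ofReal_mul (by positivity),
      ← ENNReal.ofReal_mul (div_nonneg (pow_nonneg ht.1.le m) (Real.sqrt_nonneg _))]
    congr 1
    rw [one_pow]
    ring
  rw [setLIntegral_congr_fun measurableSet_Ioo h1, lintegral_lintegral_swap hGm.aemeasurable,
    setLIntegral_congr_fun measurableSet_Ioo h2, lintegral_mul_const _ (by fun_prop),
    lintegral_pow_div_sqrt one_pos, ← ENNReal.ofReal_mul (by simpa using wallis_nonneg m)]
  congr 1
  ring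

/-- The complementary integral `K'`, as a function of the modulus. -/
noncomputable def complementaryK (u : ℝ) : ℝ :=
  ∫ θ in Set.Ioo 0 (π / 2), 1 / √(1 - (1 - u ^ 2) * sin θ ^ 2)

lemma complementaryK_neg (u : ℝ) : complementaryK (-u) = complementaryK u := by
  simp [complementaryK]

lemma K_eq_complementaryK {x : ℝ} (hx : x ∈ Set.Icc 0 1) :
    K (2 * √(x * (1 - x))) = complementaryK (2 * x - 1) := by
  have h : (2 * √(x * (1 - x))) ^ 2 = 1 - (2 * x - 1) ^ 2 := by
    rw [mul_pow, Real.sq_sqrt (mul_nonneg hx.1 (sub_nonneg.2 hx.2))]; ring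
  rw [K, complementaryK, h]

lemma integrable_pow_mul_complementary_kernel (m : ℕ) :
    Integrable (fun p : ℝ × ℝ => p.1 ^ m * (1 / √(1 - (1 - p.1 ^ 2) * sin p.2 ^ 2)))
      ((volume.restrict (Set.Ioo 0 1)).prod (volume.restrict (Set.Ioo 0 (π / 2)))) ∧
    ∫ u in Set.Ioo (0 : ℝ) 1, u ^ m * complementaryK u = wallis m ^ 2 := by
  set F : ℝ × ℝ → ℝ := fun p => p.1 ^ m * (1 / √(1 - (1 - p.1 ^ 2) * sin p.2 ^ 2)) with hF
  set μ : Measure (ℝ × ℝ) :=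
    (volume.restrict (Set.Ioo 0 1)).prod (volume.restrict (Set.Ioo 0 (π / 2))) with hμ
  have hFm : Measurable F := by fun_prop
  have hnn : 0 ≤ᵐ[μ] F := by
    rw [hμ, Measure.prod_restrict]
    filter_upwards [self_mem_ae_restrict (measurableSet_Ioo.prod measurableSet_Ioo)] with p hp
    exact mul_nonneg (pow_nonneg hp.1.1.le m) (by positivity)
  have hlint : ∫⁻ p, ENNReal.ofReal (F p) ∂μ = ENNReal.ofReal (wallis m ^ 2) := by
    rw [hμ, lintegral_prod _ (by fun_prop), ← lintegral_pow_mul_complementary_kernel]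
  have hint : Integrable F μ :=
    (lintegral_ofReal_ne_top_iff_integrable hFm.aestronglyMeasurable hnn).1
      (by rw [hlint]; exact ENNReal.ofReal_ne_top)
  refine ⟨hint, ?_⟩
  have h := integral_prod F hint
  rw [integral_eq_lintegral_of_nonneg_ae hnn hFm.aestronglyMeasurable, hlint,
    ENNReal.toReal_ofReal (sq_nonneg _)] at h
  rw [h]
  simp only [hF, complementaryK, integral_const_mul]

lemma intervalIntegrable_complementaryK : IntervalIntegrable complementaryK volume (-1) 1 := by
  have h : IntegrableOn complementaryK (Set.Ioo 0 1) := by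
    have := (integrable_pow_mul_complementary_kernel 0).1.integral_prod_left
    simp only [pow_zero, one_mul] at this
    exact this
  have h01 : IntervalIntegrable complementaryK volume 0 1 := by
    rwa [intervalIntegrable_iff_integrableOn_Ioo_of_le zero_le_one]
  refine IntervalIntegrable.trans (b := 0) ?_ h01
  simpa [complementaryK_neg] using (IntervalIntegrable.iff_comp_neg (by finiteness)).1 h01.symm

lemma integral_pow_even_mul_complementaryK (n : ℕ) :
    ∫ u in (-1 : ℝ)..1, u ^ (2 * n) * complementaryK u = π ^ 2 / 2 * halfCoeff n ^ 2 := by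
  have hint : IntervalIntegrable (fun u : ℝ => u ^ (2 * n) * complementaryK u) volume (-1) 1 :=
    intervalIntegrable_complementaryK.continuousOn_mul (by fun_prop)
  have hneg : ∫ u in (-1 : ℝ)..0, u ^ (2 * n) * complementaryK u =
      ∫ u in (0 : ℝ)..1, u ^ (2 * n) * complementaryK u := by
    have := intervalIntegral.integral_comp_neg (fun u : ℝ => u ^ (2 * n) * complementaryK u)
      (a := 0) (b := 1)
    simpa [complementaryK_neg, (even_two_mul n).neg_pow] using this.symm
  rw [← intervalIntegral.integral_add_adjacent_intervals (b := 0)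
    (hint.mono_set (by rw [Set.uIcc_of_le, Set.uIcc_of_le] <;> norm_num [Set.Icc_subset_Icc_iff]))
    (hint.mono_set (by rw [Set.uIcc_of_le, Set.uIcc_of_le] <;> norm_num [Set.Icc_subset_Icc_iff])),
    hneg, intervalIntegral.integral_of_le zero_le_one, integral_Ioc_eq_integral_Ioo,
    (integrable_pow_mul_complementary_kernel (2 * n)).2, wallis_even]
  ring

lemma integral_complementaryK_mul_legendreEven (n : ℕ) :
    ∫ u in (-1 : ℝ)..1, complementaryK u * legendreEven n u =
      π ^ 2 / 2 * ((-1) ^ n * halfCoeff n ^ 3) := by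
  have h : ∀ u, complementaryK u * legendreEven n u = ∑ k ∈ Finset.range (n + 1),
      legendreEvenCoeff n k * (u ^ (2 * k) * complementaryK u) := fun u => by
    rw [legendreEven, Finset.mul_sum]
    exact Finset.sum_congr rfl fun k _ => by ring
  simp only [h]
  rw [intervalIntegral.integral_finsetSum fun k _ =>
    (intervalIntegrable_complementaryK.continuousOn_mul (by fun_prop)).const_mul _,
    ← sum_legendreEvenCoeff_mul_sq, Finset.mul_sum]
  refine Finset.sum_congr rfl fun k _ => ?_
  rw [intervalIntegral.integral_const_mul, integral_pow_even_mul_complementaryK]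
  ring

lemma legendreOdd_neg (n : ℕ) (u : ℝ) : legendreOdd n (-u) = -legendreOdd n u := by
  simp [legendreOdd, pow_succ, pow_mul]

lemma integral_complementaryK_mul_legendreOdd (n : ℕ) :
    ∫ u in (-1 : ℝ)..1, complementaryK u * legendreOdd n u = 0 := by
  have := intervalIntegral.integral_comp_neg (fun u : ℝ => complementaryK u * legendreOdd n u)
    (a := -1) (b := 1)
  simp only [complementaryK_neg, legendreOdd_neg, mul_neg, intervalIntegral.integral_neg,
    neg_neg] at this
  linarith

lemma hasSum_integral_complementaryK_mul_legendre {a : ℝ} (ha : |a| < 1) :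
    HasSum (fun n => ∫ u in (-1 : ℝ)..1, complementaryK u * (a ^ n * legendre n u))
      (∫ u in (-1 : ℝ)..1, complementaryK u * (1 / √(1 - 2 * u * a + a ^ 2))) := by
  have habs : ∀ u ∈ Set.uIoc (-1 : ℝ) 1, |u| ≤ 1 := fun u hu => by
    rw [Set.uIoc_of_le (by norm_num)] at hu
    exact abs_le.2 ⟨hu.1.le, hu.2⟩
  have hgeom := summable_geometric_of_lt_one (abs_nonneg a) ha
  refine intervalIntegral.hasSum_integral_of_dominated_convergence
    (fun n u => |complementaryK u| * |a| ^ n) (fun n => ?_) (fun n => ?_) ?_ ?_ ?_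
  · exact (intervalIntegrable_iff.1 intervalIntegrable_complementaryK).aestronglyMeasurable.mul
      (((continuous_legendre n).const_mul _).aestronglyMeasurable)
  · refine Eventually.of_forall fun u hu => ?_
    rw [norm_mul, norm_mul, norm_pow]
    simp only [Real.norm_eq_abs]
    gcongr
    exact mul_le_of_le_one_right (by positivity) (abs_legendre_le (habs u hu) n)
  · exact Eventually.of_forall fun u _ => hgeom.mul_left _
  · simp only [tsum_mul_left]
    exact intervalIntegrable_complementaryK.abs.mul_const _
  · exact Eventually.of_forall fun u hu => (hasSum_legendre ha (habs u hu)).mul_left _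

lemma integral_complementaryK_mul_pow_mul_legendre (a : ℝ) (n : ℕ) {f : ℝ → ℝ}
    (hf : ∀ u : ℝ, |u| ≤ 1 → legendre n u = f u) :
    ∫ u in (-1 : ℝ)..1, complementaryK u * (a ^ n * legendre n u) =
      a ^ n * ∫ u in (-1 : ℝ)..1, complementaryK u * f u := by
  rw [← intervalIntegral.integral_const_mul]
  refine intervalIntegral.integral_congr fun u hu => ?_
  rw [Set.uIcc_of_le (by norm_num)] at hu
  rw [hf u (abs_le.2 hu)]
  ring

theorem stmt11 (a : ℝ) (ha : |a| < 1) :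
    ∫ x in (0:ℝ)..1, K (2 * Real.sqrt (x * (1 - x))) /
        Real.sqrt (1 - 2 * (2 * x - 1) * a + a ^ 2) =
      (Real.pi ^ 2 / 4) *
        ∑' n : ℕ, (-1 : ℝ) ^ n * (poch (1/2) n ^ 3 / poch 1 n ^ 3) * a ^ (2 * n) := by
  have hsubst : ∫ x in (0:ℝ)..1, K (2 * √(x * (1 - x))) / √(1 - 2 * (2 * x - 1) * a + a ^ 2) =
      2⁻¹ * ∫ u in (-1 : ℝ)..1, complementaryK u * (1 / √(1 - 2 * u * a + a ^ 2)) := by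
    have h := intervalIntegral.integral_comp_mul_sub
      (fun u => complementaryK u * (1 / √(1 - 2 * u * a + a ^ 2))) (a := 0) (b := 1)
      (two_ne_zero (α := ℝ)) 1
    norm_num only [smul_eq_mul] at h
    norm_num only
    rw [← h]
    refine intervalIntegral.integral_congr fun x hx => ?_
    rw [Set.uIcc_of_le zero_le_one] at hx
    rw [K_eq_complementaryK hx, ← div_eq_mul_one_div]
  have hsum := hasSum_integral_complementaryK_mul_legendre ha
  have hinj : Function.Injective fun n : ℕ => 2 * n := fun m n h => by simpa using h
  rw [← hinj.hasSum_iff] at hsum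
  · rw [hsubst, ← hsum.tsum_eq, ← tsum_mul_left, ← tsum_mul_left]
    refine tsum_congr fun n => ?_
    simp only [Function.comp_apply]
    rw [integral_complementaryK_mul_pow_mul_legendre a (2 * n) fun u hu => legendre_even hu n,
      integral_complementaryK_mul_legendreEven, halfCoeff, div_pow]
    ring
  · intro n hn
    obtain ⟨k, rfl | rfl⟩ := n.even_or_odd'
    · exact absurd ⟨k, rfl⟩ hn
    · rw [integral_complementaryK_mul_pow_mul_legendre a (2 * k + 1) fun u hu => legendre_odd hu k,
        integral_complementaryK_mul_legendreOdd, mul_zero]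
end

section
/- ∫₀¹ K(2√(x(1-x))) / √(9/8 + (1-2x)/√2) dx = Γ(1/4)⁴ / (16√2 π). -/
open MeasureTheory Real Filter

/-- The Taylor coefficients `(2n-1)‼ / (2n)‼` of `1 / √(1 - x)`. -/
noncomputable def wallisCoeff (n : ℕ) : ℝ :=
  ∏ i ∈ Finset.range n, ((2 * (i : ℝ) + 1) / (2 * i + 2))

lemma wallisCoeff_zero : wallisCoeff 0 = 1 := by simp [wallisCoeff]

lemma wallisCoeff_succ (n : ℕ) :
    wallisCoeff (n + 1) = wallisCoeff n * ((2 * (n : ℝ) + 1) / (2 * n + 2)) :=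
  Finset.prod_range_succ _ _

lemma wallisCoeff_nonneg (n : ℕ) : 0 ≤ wallisCoeff n :=
  Finset.prod_nonneg fun i _ => by positivity

lemma wallisCoeff_le_one (n : ℕ) : wallisCoeff n ≤ 1 :=
  Finset.prod_le_one (fun i _ => by positivity) fun i _ => by
    rw [div_le_one (by positivity)]; linarith

/-- Coefficients of `₂F₁(1/4,3/4;1;w)`. -/
noncomputable def quarterCoeff (n : ℕ) : ℝ := wallisCoeff (2 * n) * wallisCoeff n

/-- Coefficients of `₃F₂(1/4,3/4,1/2;1,1;4w)`. -/
noncomputable def cubicCoeff (n : ℕ) : ℝ := 4 ^ n * (wallisCoeff (2 * n) * wallisCoeff n ^ 2)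

lemma quarterCoeff_succ (n : ℕ) :
    ((n : ℝ) + 1) ^ 2 * quarterCoeff (n + 1) = (n ^ 2 + n + 3 / 16) * quarterCoeff n := by
  rw [quarterCoeff, quarterCoeff, show 2 * (n + 1) = 2 * n + 1 + 1 by ring, wallisCoeff_succ,
    wallisCoeff_succ, wallisCoeff_succ]
  push_cast
  field_simp
  ring

lemma cubicCoeff_succ (n : ℕ) :
    ((n : ℝ) + 1) ^ 3 * cubicCoeff (n + 1) =
      2 * (2 * n + 1) * (n ^ 2 + n + 3 / 16) * cubicCoeff n := by
  rw [cubicCoeff, cubicCoeff, show 2 * (n + 1) = 2 * n + 1 + 1 by ring, wallisCoeff_succ,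
    wallisCoeff_succ, wallisCoeff_succ]
  push_cast
  field_simp
  ring

namespace PowerSeries

/-- The derivation `X (1 - X) d/dX`. -/
noncomputable def thetaOp (f : PowerSeries ℝ) : PowerSeries ℝ := (X - X ^ 2) * derivative ℝ f

/-- The operator annihilating the square of `₂F₁(1/4,3/4;1;X)`. -/
noncomputable def squareOp (f : PowerSeries ℝ) : PowerSeries ℝ :=
  derivative ℝ (thetaOp (thetaOp f)) - C (3 / 4 : ℝ) * thetaOp f - C (3 / 8 : ℝ) * ((1 - 2 * X) * f)

lemma squareOp_sub (f g : PowerSeries ℝ) : squareOp (f - g) = squareOp f - squareOp g := by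
  simp only [squareOp, thetaOp, map_sub, mul_sub]
  ring

lemma squareOp_add (f g : PowerSeries ℝ) : squareOp (f + g) = squareOp f + squareOp g := by
  simp only [squareOp, thetaOp, map_add, mul_add]
  ring

lemma derivative_C_mul (r : ℝ) (f : PowerSeries ℝ) :
    derivative ℝ (C r * f) = C r * derivative ℝ f := by
  rw [← smul_eq_C_mul, ← smul_eq_C_mul, (derivative ℝ).map_smul]

lemma squareOp_C_mul (r : ℝ) (f : PowerSeries ℝ) : squareOp (C r * f) = C r * squareOp f := by
  have h (f : PowerSeries ℝ) : thetaOp (C r * f) = C r * thetaOp f := by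
    simp only [thetaOp, derivative_C_mul]; ring
  simp only [squareOp, h, derivative_C_mul]
  ring

lemma derivative_X_sub_sq : derivative ℝ (X - X ^ 2 : PowerSeries ℝ) = 1 - 2 * X := by
  simp [Derivation.leibniz_pow]

lemma coeff_succ_thetaOp (f : PowerSeries ℝ) (n : ℕ) :
    coeff (n + 1) (thetaOp f) = (n + 1) * coeff (n + 1) f - n * coeff n f := by
  rw [thetaOp, sub_mul, map_sub, coeff_succ_X_mul, pow_two, mul_assoc, coeff_succ_X_mul]
  cases n with
  | zero => simp [coeff_derivative]
  | succ m => simp [coeff_derivative]; ring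

lemma coeff_zero_thetaOp (f : PowerSeries ℝ) : coeff 0 (thetaOp f) = 0 := by
  simp [thetaOp]

lemma coeff_eq_zero_of_coeff_squareOp_eq_zero {f : PowerSeries ℝ} {M : ℕ} (h0 : coeff 0 f = 0)
    (h : ∀ n < M, coeff n (squareOp f) = 0) : ∀ n ≤ M, coeff n f = 0 := by
  intro n
  induction n using Nat.strong_induction_on with
  | _ n ih =>
    intro hn
    rcases n with _ | n
    · exact h0
    have h1 := h n (by omega)
    have hθ (j : ℕ) (hj : j ≤ n) : coeff j (thetaOp f) = 0 := by
      rcases j with _ | j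
      · exact coeff_zero_thetaOp f
      · rw [coeff_succ_thetaOp, ih (j + 1) (by omega) (by omega), ih j (by omega) (by omega)]
        simp
    have hlast : coeff n ((1 - 2 * X) * f) = 0 := by
      rw [sub_mul, one_mul, map_sub, mul_assoc, ih n (by omega) (by omega)]
      rcases n with _ | n
      · simp
      · have : (2 : PowerSeries ℝ) = C 2 := (map_ofNat C 2).symm
        rw [this, coeff_C_mul, coeff_succ_X_mul, ih n (by omega) (by omega)]
        simp
    rw [squareOp, map_sub, map_sub, coeff_C_mul, coeff_C_mul, hlast, hθ n le_rfl, coeff_derivative,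
      coeff_succ_thetaOp, hθ n le_rfl, coeff_succ_thetaOp, ih n (by omega) (by omega)] at h1
    have : ((n : ℝ) + 1) ^ 3 * coeff (n + 1) f = 0 := by linear_combination h1
    simpa [show (n : ℝ) + 1 ≠ 0 by positivity] using this

lemma squareOp_sq {H : PowerSeries ℝ} (hH : derivative ℝ (thetaOp H) = C (3 / 16 : ℝ) * H) :
    squareOp (H ^ 2) = 0 := by
  have h1 : thetaOp (H ^ 2) = 2 * (H * thetaOp H) := by
    rw [thetaOp, Derivation.leibniz_pow, thetaOp]
    simp only [smul_eq_mul, nsmul_eq_mul, Nat.cast_ofNat, Nat.add_one_sub_one, pow_one]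
    ring
  have h2 : thetaOp (2 * (H * thetaOp H)) =
      2 * thetaOp H ^ 2 + C (3 / 8 : ℝ) * ((X - X ^ 2) * H ^ 2) := by
    rw [thetaOp, ← map_ofNat (C (R := ℝ)) 2, derivative_C_mul, Derivation.leibniz, hH,
      show (3 / 8 : ℝ) = 2 * (3 / 16) by norm_num, map_mul C]
    simp only [smul_eq_mul]
    rw [thetaOp]
    ring
  rw [squareOp, h1, h2, map_add, derivative_C_mul, Derivation.leibniz (derivative ℝ) (X - X ^ 2),
    derivative_X_sub_sq, ← map_ofNat (C (R := ℝ)) 2, derivative_C_mul, Derivation.leibniz_pow,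
    Derivation.leibniz_pow, hH]
  simp only [smul_eq_mul, nsmul_eq_mul, Nat.cast_ofNat, Nat.add_one_sub_one, pow_one]
  rw [show (3 / 8 : ℝ) = 2 * (3 / 16) by norm_num, show (3 / 4 : ℝ) = 2 * (2 * (3 / 16)) by norm_num,
    map_mul C, map_mul C, map_mul C]
  rw [thetaOp, map_ofNat (C (R := ℝ)) 2]
  ring

lemma squareOp_quarter : squareOp ((mk quarterCoeff) ^ 2) = 0 := by
  apply squareOp_sq
  ext n
  rw [coeff_derivative, coeff_succ_thetaOp, coeff_C_mul, coeff_mk, coeff_mk]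
  linear_combination quarterCoeff_succ n

lemma thetaOp_pow (n : ℕ) :
    thetaOp ((X - X ^ 2) ^ n) = C (n : ℝ) * ((X - X ^ 2) ^ n * (1 - 2 * X)) := by
  rcases n with _ | n
  · simp [thetaOp]
  · rw [thetaOp, Derivation.leibniz_pow, derivative_X_sub_sq]
    simp only [smul_eq_mul, nsmul_eq_mul, Nat.add_one_sub_one, map_natCast]
    ring

lemma thetaOp_thetaOp_pow (n : ℕ) :
    thetaOp (thetaOp ((X - X ^ 2) ^ n)) = C ((n : ℝ) ^ 2) * (X - X ^ 2) ^ n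
      - C (4 * (n : ℝ) ^ 2 + 2 * n) * (X - X ^ 2) ^ (n + 1) := by
  have h : derivative ℝ (1 - 2 * X : PowerSeries ℝ) = -2 := by
    rw [← map_ofNat (C (R := ℝ)) 2, map_sub, derivative_C_mul]
    simp
  rw [thetaOp_pow]
  have : thetaOp (C (n : ℝ) * ((X - X ^ 2) ^ n * (1 - 2 * X))) =
      C (n : ℝ) * ((1 - 2 * X) * thetaOp ((X - X ^ 2) ^ n) - 2 * (X - X ^ 2) ^ (n + 1)) := by
    rw [thetaOp, derivative_C_mul, Derivation.leibniz, h, thetaOp]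
    simp only [smul_eq_mul]
    ring
  rw [this, thetaOp_pow]
  simp only [map_add, map_mul, map_pow, map_natCast, map_ofNat]
  ring

lemma squareOp_pow_succ (n : ℕ) :
    squareOp ((X - X ^ 2) ^ (n + 1)) = C (((n : ℝ) + 1) ^ 3) * ((X - X ^ 2) ^ n * (1 - 2 * X))
      - C (2 * (2 * ((n : ℝ) + 1) + 1) * (((n : ℝ) + 1) ^ 2 + (n + 1) + 3 / 16)) *
        ((X - X ^ 2) ^ (n + 1) * (1 - 2 * X)) := by
  rw [squareOp, thetaOp_thetaOp_pow, thetaOp_pow, map_sub, derivative_C_mul, derivative_C_mul,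
    Derivation.leibniz_pow, Derivation.leibniz_pow, derivative_X_sub_sq,
    show 2 * (2 * ((n : ℝ) + 1) + 1) * (((n : ℝ) + 1) ^ 2 + (n + 1) + 3 / 16) =
      2 * (2 * ((n : ℝ) + 1) + 1) * (((n : ℝ) + 1) ^ 2 + (n + 1)) + 3 / 4 * (n + 1) + 3 / 8 by ring]
  simp only [smul_eq_mul, nsmul_eq_mul, Nat.add_one_sub_one, map_natCast, map_add, map_mul,
    map_pow, map_ofNat, map_one, Nat.cast_add, Nat.cast_one]
  ring

lemma squareOp_sum (M : ℕ) :
    squareOp (∑ n ∈ Finset.range (M + 1), C (cubicCoeff n) * (X - X ^ 2) ^ n) =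
      - C (2 * (2 * (M : ℝ) + 1) * ((M : ℝ) ^ 2 + M + 3 / 16) * cubicCoeff M) *
        ((X - X ^ 2) ^ M * (1 - 2 * X)) := by
  induction M with
  | zero =>
    have : cubicCoeff 0 = 1 := by simp [cubicCoeff, wallisCoeff_zero]
    have h : C (2 * (3 / 16) : ℝ) = C (3 / 8) := by norm_num
    simp [squareOp, thetaOp, this, ← map_ofNat (C (R := ℝ)) 2, -map_mul, h]
  | succ M ih =>
    rw [Finset.sum_range_succ, squareOp_add, ih, squareOp_C_mul, squareOp_pow_succ,
      ← cubicCoeff_succ]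
    push_cast
    simp only [map_mul C]
    ring

lemma X_pow_dvd_parabola_pow (M : ℕ) : (X : PowerSeries ℝ) ^ M ∣ (X - X ^ 2) ^ M :=
  pow_dvd_pow_of_dvd ⟨1 - X, by ring⟩ M

lemma coeff_sum_eq_coeff_sq (M n : ℕ) (hn : n ≤ M) :
    coeff n (∑ n ∈ Finset.range (M + 1), C (cubicCoeff n) * (X - X ^ 2) ^ n) =
      coeff n ((mk quarterCoeff) ^ 2) := by
  rw [← sub_eq_zero, ← map_sub]
  refine coeff_eq_zero_of_coeff_squareOp_eq_zero (M := M) ?_ ?_ n hn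
  · have h1 : cubicCoeff 0 = 1 := by simp [cubicCoeff, wallisCoeff_zero]
    have h2 : quarterCoeff 0 = 1 := by simp [quarterCoeff, wallisCoeff_zero]
    simp [Finset.sum_range_succ', h1, h2]
  · intro k hk
    rw [squareOp_sub, squareOp_quarter, sub_zero, squareOp_sum]
    refine X_pow_dvd_iff.mp ?_ k hk
    exact ((X_pow_dvd_parabola_pow M).mul_right _).mul_left _

lemma coeff_parabola_pow (n N : ℕ) :
    coeff N ((X - X ^ 2 : PowerSeries ℝ) ^ n) =
      if n ≤ N then (-1) ^ (N - n) * (n.choose (N - n) : ℝ) else 0 := by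
  rw [show (X - X ^ 2 : PowerSeries ℝ) = X * (1 + (- X)) by ring, mul_pow, coeff_X_pow_mul']
  split_ifs with h
  · have : (1 + (-X) : PowerSeries ℝ) ^ n =
        rescale (-1 : ℝ) (((1 + Polynomial.X) ^ n : Polynomial ℝ) : PowerSeries ℝ) := by
      simp [rescale_X]
    rw [this, coeff_rescale, Polynomial.coeff_coe, Polynomial.coeff_one_add_X_pow]
  · rfl

lemma sum_antidiagonal_eq (N : ℕ) :
    ∑ p ∈ Finset.HasAntidiagonal.antidiagonal N,
        cubicCoeff p.1 * ((-1) ^ p.2 * (p.1.choose p.2 : ℝ)) =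
      ∑ p ∈ Finset.HasAntidiagonal.antidiagonal N, quarterCoeff p.1 * quarterCoeff p.2 := by
  have h := coeff_sum_eq_coeff_sq N N le_rfl
  rw [pow_two (mk quarterCoeff), coeff_mul] at h
  simp only [coeff_mk] at h
  rw [← h, map_sum, Finset.Nat.sum_antidiagonal_eq_sum_range_succ_mk]
  refine Finset.sum_congr rfl fun n hn => ?_
  rw [coeff_C_mul, coeff_parabola_pow, if_pos (by simpa [Nat.lt_succ_iff] using hn)]

end PowerSeries

lemma quarterCoeff_nonneg (n : ℕ) : 0 ≤ quarterCoeff n :=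
  mul_nonneg (wallisCoeff_nonneg _) (wallisCoeff_nonneg _)

lemma quarterCoeff_le_one (n : ℕ) : quarterCoeff n ≤ 1 :=
  mul_le_one₀ (wallisCoeff_le_one _) (wallisCoeff_nonneg _) (wallisCoeff_le_one _)

lemma cubicCoeff_nonneg (n : ℕ) : 0 ≤ cubicCoeff n :=
  mul_nonneg (by positivity) (mul_nonneg (wallisCoeff_nonneg _) (sq_nonneg _))

lemma cubicCoeff_le (n : ℕ) : cubicCoeff n ≤ 4 ^ n :=
  mul_le_of_le_one_right (by positivity) (mul_le_one₀ (wallisCoeff_le_one _) (sq_nonneg _)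
    (pow_le_one₀ (wallisCoeff_nonneg _) (wallisCoeff_le_one _)))

lemma hasSum_choose_mul_pow (n : ℕ) (x : ℝ) :
    HasSum (fun j : ℕ => (n.choose j : ℝ) * x ^ j) ((1 + x) ^ n) := by
  have h : (1 + x) ^ n = ∑ j ∈ Finset.range (n + 1), (n.choose j : ℝ) * x ^ j := by
    rw [add_comm, add_pow]
    exact Finset.sum_congr rfl fun j _ => by ring
  rw [h]
  refine hasSum_sum_of_ne_finset_zero fun j hj => ?_
  rw [Nat.choose_eq_zero_of_lt (by simpa [Nat.lt_succ_iff] using hj)]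
  simp

/-- Clausen's identity `₃F₂(1/4,3/4,1/2;1,1;4w(1-w)) = ₂F₁(1/4,3/4;1;w)²`. -/
theorem tsum_cubicCoeff_eq_sq {w : ℝ} (hw : 0 ≤ w) (hw' : 4 * (w * (1 + w)) < 1) :
    ∑' n, cubicCoeff n * (w * (1 - w)) ^ n = (∑' n, quarterCoeff n * w ^ n) ^ 2 := by
  have hw1 : w < 1 := by nlinarith
  let F : ℕ × ℕ → ℝ := fun p =>
    cubicCoeff p.1 * w ^ p.1 * ((p.1.choose p.2 : ℝ) * (-w) ^ p.2)
  have hrow (n : ℕ) : HasSum (fun j => F (n, j)) (cubicCoeff n * (w * (1 - w)) ^ n) := by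
    rw [mul_pow, ← mul_assoc, sub_eq_add_neg]
    exact (hasSum_choose_mul_pow n (-w)).mul_left _
  have hrow' (n : ℕ) : HasSum (fun j => ‖F (n, j)‖) (cubicCoeff n * (w * (1 + w)) ^ n) := by
    rw [mul_pow, ← mul_assoc]
    refine ((hasSum_choose_mul_pow n w).mul_left _).congr_fun fun j => ?_
    simp only [F, norm_mul, norm_pow, norm_neg, Real.norm_eq_abs, abs_of_nonneg hw,
      abs_of_nonneg (cubicCoeff_nonneg n), Nat.abs_cast]
  have hF : Summable F := by
    refine Summable.of_norm ((summable_prod_of_nonneg fun _ => norm_nonneg _).2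
      ⟨fun n => (hrow' n).summable, ?_⟩)
    simp only [fun n => (hrow' n).tsum_eq]
    refine Summable.of_nonneg_of_le (fun n => ?_) (fun n => ?_)
      (summable_geometric_of_lt_one (r := 4 * (w * (1 + w))) (by positivity) hw')
    · exact mul_nonneg (cubicCoeff_nonneg n) (by positivity)
    · rw [mul_pow 4]
      exact mul_le_mul_of_nonneg_right (cubicCoeff_le n) (by positivity)
  have hH : Summable fun n => ‖quarterCoeff n * w ^ n‖ := by
    refine Summable.of_nonneg_of_le (fun n => norm_nonneg _) (fun n => ?_)
      (summable_geometric_of_lt_one hw hw1)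
    rw [Real.norm_of_nonneg (mul_nonneg (quarterCoeff_nonneg n) (by positivity))]
    exact mul_le_of_le_one_left (by positivity) (quarterCoeff_le_one n)
  rw [pow_two, tsum_mul_tsum_eq_tsum_sum_antidiagonal_of_summable_norm hH hH,
    tsum_congr fun n => (hrow n).tsum_eq.symm, ← hF.tsum_prod,
    ← Finset.HasAntidiagonal.sigmaAntidiagonalEquivProd.tsum_eq]
  refine ((Finset.HasAntidiagonal.sigmaAntidiagonalEquivProd.summable_iff.2 hF).tsum_sigma'
    (fun N => (hasSum_fintype _).summable)).trans (tsum_congr fun N => ?_)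
  rw [tsum_fintype]
  simp only [Function.comp_apply, Finset.HasAntidiagonal.sigmaAntidiagonalEquivProd_apply]
  rw [Finset.sum_coe_sort (Finset.HasAntidiagonal.antidiagonal N) F]
  have h := congrArg (· * w ^ N) (PowerSeries.sum_antidiagonal_eq N)
  simp only [Finset.sum_mul] at h
  refine (Finset.sum_congr rfl fun p hp => ?_).trans (h.trans (Finset.sum_congr rfl fun p hp => ?_))
  · rw [← Finset.HasAntidiagonal.mem_antidiagonal.1 hp, pow_add]
    simp only [F]
    rw [neg_pow w]
    ring
  · rw [← Finset.HasAntidiagonal.mem_antidiagonal.1 hp, pow_add]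
    ring

lemma choose_eq_wallisCoeff (n : ℕ) : Ring.choose ((1 / 2 : ℝ) + n - 1) n = wallisCoeff n := by
  have h (m : ℕ) : (m.factorial : ℝ) * wallisCoeff m = (ascPochhammer ℝ m).eval (1 / 2) := by
    induction m with
    | zero => simp [wallisCoeff_zero]
    | succ m ih =>
      rw [ascPochhammer_succ_eval, ← ih, wallisCoeff_succ, Nat.factorial_succ]
      push_cast
      field_simp
      ring
  have h1 := Ring.factorial_nsmul_multichoose_eq_ascPochhammer (1 / 2 : ℝ) n
  rw [Polynomial.ascPochhammer_smeval_eq_eval, ← h, nsmul_eq_mul] at h1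
  rw [← Ring.multichoose_eq]
  exact mul_left_cancel₀ (Nat.cast_ne_zero.2 n.factorial_ne_zero) h1

lemma hasSum_wallisCoeff {x : ℝ} (hx : |x| < 1) :
    HasSum (fun n => wallisCoeff n * x ^ n) (1 / √(1 - x)) := by
  have h := (Real.one_div_one_sub_rpow_hasFPowerSeriesOnBall_zero (1 / 2)).hasSum (y := x)
    (by simpa [enorm_eq_nnnorm, ← NNReal.coe_lt_coe] using hx)
  rw [zero_add, ← Real.sqrt_eq_rpow] at h
  refine h.congr_fun fun n => ?_
  rw [← choose_eq_wallisCoeff]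
  simp [mul_comm]

lemma integral_cos_pow_even_half (n : ℕ) :
    ∫ x in (0 : ℝ)..π / 2, cos x ^ (2 * n) = π / 2 * wallisCoeff n := by
  rw [EulerSine.integral_cos_pow_eq, integral_sin_pow_even, wallisCoeff]
  ring

lemma integral_cos_pow_zero_pi (n : ℕ) :
    ∫ x in (0 : ℝ)..π, cos x ^ n = (1 + (-1) ^ n) * ∫ x in (0 : ℝ)..π / 2, cos x ^ n := by
  have hi (a b : ℝ) : IntervalIntegrable (fun x => cos x ^ n) volume a b :=
    (by fun_prop : Continuous fun x => cos x ^ n).intervalIntegrable a b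
  have h : ∫ x in π / 2..π, cos x ^ n = (-1) ^ n * ∫ x in (0 : ℝ)..π / 2, cos x ^ n := by
    have := intervalIntegral.integral_comp_sub_left (fun x => cos x ^ n) π (a := 0) (b := π / 2)
    rw [sub_zero, sub_half] at this
    rw [← this, ← intervalIntegral.integral_const_mul]
    refine intervalIntegral.integral_congr fun x _ => ?_
    simp only [cos_pi_sub, neg_pow (cos x)]
  rw [← intervalIntegral.integral_add_adjacent_intervals (hi 0 (π / 2)) (hi _ _), h]
  ring

lemma integral_cos_pow_even_pi (n : ℕ) :
    ∫ x in (0 : ℝ)..π, cos x ^ (2 * n) = π * wallisCoeff n := by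
  rw [integral_cos_pow_zero_pi, integral_cos_pow_even_half]
  simp [pow_mul]
  ring

lemma integral_cos_pow_odd_pi (n : ℕ) : ∫ x in (0 : ℝ)..π, cos x ^ (2 * n + 1) = 0 := by
  rw [integral_cos_pow_zero_pi]
  simp [pow_succ, pow_mul]

lemma hasSum_integral_comp_cos {b : ℕ → ℝ} {f : ℝ → ℝ} {r s t : ℝ} (hb : ∀ n, |b n| ≤ 1)
    (hr : |r| < 1) (hf : ∀ x, HasSum (fun n => b n * (r * cos x) ^ n) (f x)) :
    HasSum (fun n => b n * r ^ n * ∫ x in s..t, cos x ^ n) (∫ x in s..t, f x) := by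
  have h := intervalIntegral.hasSum_integral_of_dominated_convergence (μ := volume) (a := s)
    (b := t) (F := fun n x => b n * (r * cos x) ^ n) (f := f) (fun n _ => |r| ^ n)
    (fun n => (by fun_prop : Continuous fun x => b n * (r * cos x) ^ n).aestronglyMeasurable)
    (fun n => Eventually.of_forall fun x _ => by
      rw [Real.norm_eq_abs, abs_mul, abs_pow, abs_mul]
      refine (mul_le_of_le_one_left (by positivity) (hb n)).trans ?_
      gcongr
      exact mul_le_of_le_one_right (abs_nonneg r) (abs_cos_le_one x))
    (Eventually.of_forall fun _ _ => summable_geometric_of_lt_one (abs_nonneg r) hr)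
    intervalIntegrable_const (Eventually.of_forall fun x _ => hf x)
  refine h.congr_fun fun n => ?_
  rw [← intervalIntegral.integral_const_mul]
  simp only [mul_pow, mul_assoc]

lemma hasSum_even_of_odd_eq_zero {g : ℕ → ℝ} {S : ℝ} (h : HasSum g S)
    (hodd : ∀ n, g (2 * n + 1) = 0) : HasSum (fun n => g (2 * n)) S := by
  refine ((mul_right_injective₀ (two_ne_zero' ℕ)).hasSum_iff fun k hk => ?_).2 h
  rcases Nat.even_or_odd' k with ⟨m, rfl | rfl⟩
  · exact absurd ⟨m, rfl⟩ hk
  · exact hodd m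

lemma abs_wallisCoeff_le_one (n : ℕ) : |wallisCoeff n| ≤ 1 := by
  rw [abs_of_nonneg (wallisCoeff_nonneg n)]; exact wallisCoeff_le_one n

lemma abs_mul_cos_lt_one {r : ℝ} (hr : |r| < 1) (x : ℝ) : |r * cos x| < 1 := by
  rw [abs_mul]
  exact (mul_le_of_le_one_right (abs_nonneg r) (abs_cos_le_one x)).trans_lt hr

lemma hasSum_integral_inv_sqrt_cos {r : ℝ} (hr : |r| < 1) :
    HasSum (fun n => π * (quarterCoeff n * (r ^ 2) ^ n))
      (∫ x in (0 : ℝ)..π, 1 / √(1 - r * cos x)) := by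
  have h := hasSum_integral_comp_cos (s := 0) (t := π) abs_wallisCoeff_le_one hr
    fun x => hasSum_wallisCoeff (abs_mul_cos_lt_one hr x)
  refine (hasSum_even_of_odd_eq_zero h fun n => ?_).congr_fun fun n => ?_
  · rw [integral_cos_pow_odd_pi, mul_zero]
  · rw [integral_cos_pow_even_pi, quarterCoeff, ← pow_mul]
    ring

lemma hasSum_integral_integral_inv_sqrt_cos {c : ℝ} (hc : |c| < 1) :
    HasSum (fun n => π ^ 2 / 2 * (cubicCoeff n * (c ^ 2 / 4) ^ n))
      (∫ x in (0 : ℝ)..π / 2, ∫ y in (0 : ℝ)..π, 1 / √(1 - c * cos x * cos y)) := by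
  let b : ℕ → ℝ := fun n => if Even n then quarterCoeff (n / 2) else 0
  have hb0 (n : ℕ) : b (2 * n) = quarterCoeff n := by simp [b]
  have hb1 (n : ℕ) : b (2 * n + 1) = 0 := by simp [b]
  have hb (n : ℕ) : |b n| ≤ 1 := by
    rcases Nat.even_or_odd' n with ⟨m, rfl | rfl⟩
    · rw [hb0, abs_of_nonneg (quarterCoeff_nonneg m)]; exact quarterCoeff_le_one m
    · rw [hb1]; simp
  have hf (x : ℝ) : HasSum (fun n => b n * (c * cos x) ^ n)
      (π⁻¹ * ∫ y in (0 : ℝ)..π, 1 / √(1 - c * cos x * cos y)) := by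
    have h := (hasSum_integral_inv_sqrt_cos (abs_mul_cos_lt_one hc x)).mul_left π⁻¹
    refine ((mul_right_injective₀ (two_ne_zero' ℕ)).hasSum_iff fun k hk => ?_).1
      (h.congr_fun fun n => ?_)
    · rcases Nat.even_or_odd' k with ⟨m, rfl | rfl⟩
      · exact absurd ⟨m, rfl⟩ hk
      · rw [hb1, zero_mul]
    · simp only [Function.comp_apply, hb0, ← pow_mul]
      field_simp
  have h := (hasSum_even_of_odd_eq_zero (hasSum_integral_comp_cos (s := 0) (t := π / 2) hb hc hf)
    fun n => by rw [hb1]; simp).mul_left π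
  rw [intervalIntegral.integral_const_mul, mul_inv_cancel_left₀ pi_ne_zero] at h
  refine h.congr_fun fun n => ?_
  rw [hb0, integral_cos_pow_even_half, cubicCoeff, quarterCoeff, div_pow, ← pow_mul]
  field_simp

/-- The Jacobian substitution turning the lemniscate integral into a beta integral. -/
lemma integral_lemniscate :
    ∫ x in (0 : ℝ)..π / 2, 1 / √(1 + sin x ^ 2) = Gamma (1 / 4) ^ 2 / (4 * √(2 * π)) := by
  have hbeta : ProbabilityTheory.beta (1 / 4) (1 / 2) =
      4 * ∫ x in (0 : ℝ)..π / 2, 1 / √(1 + sin x ^ 2) := by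
    have hB : ProbabilityTheory.beta (1 / 4) (1 / 2) =
        ∫ x in Set.Ioo (0 : ℝ) 1, x ^ (1 / 4 - 1 : ℝ) * (1 - x) ^ (1 / 2 - 1 : ℝ) := by
      have h : Complex.betaIntegral (1 / 4 : ℝ) (1 / 2 : ℝ) =
          ((∫ x in Set.Ioo (0 : ℝ) 1, x ^ (1 / 4 - 1 : ℝ) * (1 - x) ^ (1 / 2 - 1 : ℝ) : ℝ) : ℂ) := by
        rw [Complex.betaIntegral, intervalIntegral.integral_of_le zero_le_one,
          integral_Ioc_eq_integral_Ioo, ← integral_complex_ofReal]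
        refine setIntegral_congr_fun measurableSet_Ioo fun x hx => ?_
        rw [Complex.ofReal_mul, Complex.ofReal_cpow hx.1.le, Complex.ofReal_cpow (by linarith [hx.2])]
        push_cast
        rfl
      rw [ProbabilityTheory.beta_eq_betaIntegralReal _ _ (by norm_num) (by norm_num), h,
        Complex.ofReal_re]
    have hcos {x : ℝ} (hx : x ∈ Set.Ioo 0 (π / 2)) : 0 < cos x :=
      cos_pos_of_mem_Ioo ⟨by linarith [hx.1, pi_pos], hx.2⟩
    have hsin {x : ℝ} (hx : x ∈ Set.Ioo 0 (π / 2)) : 0 < sin x :=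
      sin_pos_of_pos_of_lt_pi hx.1 (by linarith [hx.2, pi_pos])
    have himage : (fun x => sin x ^ 4) '' Set.Ioo 0 (π / 2) = Set.Ioo 0 1 := by
      ext y
      constructor
      · rintro ⟨x, hx, rfl⟩
        have h1 : sin x < 1 := by nlinarith [sin_sq_add_cos_sq x, hcos hx, hsin hx]
        exact ⟨pow_pos (hsin hx) 4, pow_lt_one₀ (hsin hx).le h1 (by norm_num)⟩
      · intro hy
        have hs1 : √(√y) < 1 := by
          rw [Real.sqrt_lt' one_pos, one_pow, Real.sqrt_lt' one_pos, one_pow]; exact hy.2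
        refine ⟨arcsin √(√y), ⟨arcsin_pos.2 (by have := hy.1; positivity),
          (arcsin_lt_pi_div_two).2 hs1⟩, ?_⟩
        simp only
        rw [sin_arcsin (by linarith [Real.sqrt_nonneg √y]) hs1.le,
          show (√√y) ^ 4 = ((√√y) ^ 2) ^ 2 by ring, Real.sq_sqrt (Real.sqrt_nonneg y),
          Real.sq_sqrt hy.1.le]
    have hinj : Set.InjOn (fun x => sin x ^ 4) (Set.Ioo 0 (π / 2)) := by
      intro x hx y hy hxy
      have h := (pow_left_inj₀ (hsin hx).le (hsin hy).le (by norm_num)).1 hxy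
      exact injOn_sin ⟨by linarith [hx.1, pi_pos], hx.2.le⟩ ⟨by linarith [hy.1, pi_pos], hy.2.le⟩ h
    have hderiv (x : ℝ) (_ : x ∈ Set.Ioo 0 (π / 2)) :
        HasDerivWithinAt (fun x => sin x ^ 4) (4 * sin x ^ 3 * cos x) (Set.Ioo 0 (π / 2)) x := by
      simpa using ((hasDerivAt_sin x).fun_pow 4).hasDerivWithinAt
    rw [hB, ← himage, integral_image_eq_integral_abs_deriv_smul measurableSet_Ioo
      hderiv hinj, intervalIntegral.integral_of_le (by positivity), integral_Ioc_eq_integral_Ioo,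
      ← integral_const_mul]
    refine setIntegral_congr_fun measurableSet_Ioo fun x hx => ?_
    have hs := hsin hx
    have hc := hcos hx
    have h1 : (sin x ^ 4) ^ (1 / 4 - 1 : ℝ) = (sin x ^ 3)⁻¹ := by
      rw [← Real.rpow_natCast, ← Real.rpow_mul hs.le, ← Real.rpow_natCast (sin x) 3,
        ← Real.rpow_neg hs.le]
      norm_num
    have h2 : (1 - sin x ^ 4) ^ (1 / 2 - 1 : ℝ) = (cos x * √(1 + sin x ^ 2))⁻¹ := by
      have : 1 - sin x ^ 4 = cos x ^ 2 * (1 + sin x ^ 2) := by rw [cos_sq']; ring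
      rw [this, show (1 / 2 - 1 : ℝ) = -(1 / 2) by norm_num, Real.rpow_neg (by positivity),
        ← Real.sqrt_eq_rpow, Real.sqrt_mul (by positivity), Real.sqrt_sq hc.le]
    simp only [smul_eq_mul]
    rw [h1, h2, abs_of_pos (by positivity)]
    field_simp
  have hrefl : Gamma (1 / 4) * Gamma (3 / 4) = π * √2 := by
    have h := Real.Gamma_mul_Gamma_one_sub (1 / 4)
    rw [show (1 - 1 / 4 : ℝ) = 3 / 4 by norm_num, show π * (1 / 4) = π / 4 by ring,
      sin_pi_div_four] at h
    rw [h]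
    field_simp
    rw [Real.sq_sqrt (by norm_num)]
  rw [ProbabilityTheory.beta, Real.Gamma_one_half_eq,
    show (1 / 4 + 1 / 2 : ℝ) = 3 / 4 by norm_num] at hbeta
  have hG : 0 < Gamma (1 / 4) := Gamma_pos_of_pos (by norm_num)
  have hG' : Gamma (3 / 4) = π * √2 / Gamma (1 / 4) := by
    rw [eq_div_iff hG.ne', mul_comm, hrefl]
  rw [← mul_right_inj' (four_ne_zero (α := ℝ)), ← hbeta, hG', Real.sqrt_mul (by norm_num)]
  have h2 : √π ^ 2 = π := Real.sq_sqrt pi_pos.le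
  field_simp
  rw [h2]

lemma tsum_quarterCoeff_one_ninth :
    ∑' n, quarterCoeff n * (1 / 9) ^ n = Gamma (1 / 4) ^ 2 * √3 / (4 * π * √π) := by
  have h := (hasSum_integral_inv_sqrt_cos (r := 1 / 3) (by norm_num [abs_of_pos])).tsum_eq
  rw [tsum_mul_left, show ((1 : ℝ) / 3) ^ 2 = 1 / 9 by norm_num] at h
  have hsub : ∫ x in (0 : ℝ)..π, 1 / √(1 - 1 / 3 * cos x) =
      √6 * ∫ x in (0 : ℝ)..π / 2, 1 / √(1 + sin x ^ 2) := by
    have := intervalIntegral.mul_integral_comp_mul_left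
      (f := fun x => 1 / √(1 - 1 / 3 * cos x)) (a := 0) (b := π / 2) (c := 2)
    rw [mul_zero, mul_div_cancel₀ _ (two_ne_zero)] at this
    rw [← this, ← intervalIntegral.integral_const_mul, ← intervalIntegral.integral_const_mul]
    refine intervalIntegral.integral_congr fun x _ => ?_
    have h1 : 1 - 1 / 3 * cos (2 * x) = 2 ^ 2 * (1 + sin x ^ 2) / 6 := by
      rw [cos_two_mul, cos_sq']; ring
    rw [h1, Real.sqrt_div (by positivity), Real.sqrt_mul (by positivity),
      Real.sqrt_sq (by norm_num)]
    field_simp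
  rw [hsub, integral_lemniscate] at h
  rw [← mul_right_inj' pi_ne_zero, h, show (6 : ℝ) = 2 * 3 by norm_num, Real.sqrt_mul (by norm_num),
    Real.sqrt_mul (by norm_num)]
  field_simp

lemma integral_integral_inv_sqrt :
    ∫ x in (0 : ℝ)..π / 2, ∫ y in (0 : ℝ)..π, 1 / √(9 / 8 + cos x * cos y / √2) =
      Gamma (1 / 4) ^ 4 / (8 * √2 * π) := by
  have h2 : √2 ^ 2 = 2 := Real.sq_sqrt (by norm_num)
  have hc2 : (-(8 / (9 * √2))) ^ 2 = (32 / 81 : ℝ) := by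
    rw [neg_sq, div_pow, mul_pow, h2]; norm_num
  have hc : |-(8 / (9 * √2))| < 1 := by
    rw [← sq_lt_one_iff_abs_lt_one, hc2]; norm_num
  have h := (hasSum_integral_integral_inv_sqrt_cos hc).tsum_eq
  have hcl := tsum_cubicCoeff_eq_sq (w := 1 / 9) (by norm_num) (by norm_num)
  rw [tsum_mul_left, hc2, show (32 / 81 / 4 : ℝ) = 1 / 9 * (1 - 1 / 9) by norm_num, hcl,
    tsum_quarterCoeff_one_ninth] at h
  have hscale (x y : ℝ) : 1 / √(9 / 8 + cos x * cos y / √2) =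
      (2 * √2 / 3) * (1 / √(1 - -(8 / (9 * √2)) * cos x * cos y)) := by
    have : 9 / 8 + cos x * cos y / √2 =
        (3 / (2 * √2)) ^ 2 * (1 - -(8 / (9 * √2)) * cos x * cos y) := by
      rw [div_pow, mul_pow, h2]
      field_simp
      ring
    rw [this, Real.sqrt_mul (by positivity), Real.sqrt_sq (by positivity)]
    rw [one_div, mul_inv, inv_div, one_div]
  simp only [hscale, intervalIntegral.integral_const_mul]
  rw [← h]
  have h3 : √3 ^ 2 = 3 := Real.sq_sqrt (by norm_num)
  have hp : √π ^ 2 = π := Real.sq_sqrt pi_pos.le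
  rw [div_pow, mul_pow, mul_pow, mul_pow, hp, h3]
  field_simp
  rw [h2]
  ring

lemma lintegral_Ioo_neg_self_div_sqrt {a : ℝ} (ha : 0 < a) (g : ℝ → ENNReal) :
    ∫⁻ u in Set.Ioo (-a) a, ENNReal.ofReal (1 / √(a ^ 2 - u ^ 2)) * g u =
      ∫⁻ β in Set.Ioo 0 π, g (a * cos β) := by
  have hinj : Set.InjOn (fun β => a * cos β) (Set.Ioo 0 π) := fun x hx y hy h =>
    injOn_cos ⟨hx.1.le, hx.2.le⟩ ⟨hy.1.le, hy.2.le⟩ (mul_left_cancel₀ ha.ne' h)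
  have himage : (fun β => a * cos β) '' Set.Ioo 0 π = Set.Ioo (-a) a := by
    ext y
    constructor
    · rintro ⟨x, hx, rfl⟩
      have hs := sin_pos_of_mem_Ioo hx
      have h : |cos x| < 1 := by
        rw [← sq_lt_one_iff_abs_lt_one]
        nlinarith [sin_sq_add_cos_sq x]
      rw [abs_lt] at h
      exact ⟨by nlinarith, by nlinarith⟩
    · rintro ⟨hy1, hy2⟩
      have h1 : -1 < y / a := by rw [lt_div_iff₀ ha]; linarith
      have h2 : y / a < 1 := by rw [div_lt_one ha]; exact hy2
      exact ⟨arccos (y / a), ⟨arccos_pos.2 h2, by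
        rw [arccos_eq_pi_div_two_sub_arcsin]; linarith [neg_pi_div_two_lt_arcsin.2 h1]⟩, by
        simp only [cos_arccos h1.le h2.le, mul_div_cancel₀ _ ha.ne']⟩
  rw [← himage, lintegral_image_eq_lintegral_abs_deriv_mul measurableSet_Ioo
    (fun x _ => ((hasDerivAt_cos x).const_mul a).hasDerivWithinAt) hinj]
  refine setLIntegral_congr_fun measurableSet_Ioo fun x hx => ?_
  have hs := sin_pos_of_mem_Ioo hx
  have h : √(a ^ 2 - (a * cos x) ^ 2) = a * sin x := by
    rw [← Real.sqrt_sq (mul_pos ha hs).le, mul_pow a (sin x), sin_sq]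
    ring_nf
  rw [h, mul_neg, abs_neg, abs_of_pos (mul_pos ha hs), ← mul_assoc,
    ← ENNReal.ofReal_mul (by positivity), mul_one_div_cancel (mul_pos ha hs).ne',
    ENNReal.ofReal_one, one_mul]

lemma lintegral_Ioo_zero_one_div_sqrt (g : ℝ → ENNReal) :
    ∫⁻ a in Set.Ioo 0 1, ENNReal.ofReal (1 / √(1 - a ^ 2)) * g a =
      ∫⁻ α in Set.Ioo 0 (π / 2), g (cos α) := by
  have hsub {x : ℝ} (hx : x ∈ Set.Ioo 0 (π / 2)) : x ∈ Set.Ioo 0 π :=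
    ⟨hx.1, by linarith [hx.2, pi_pos]⟩
  have hinj : Set.InjOn cos (Set.Ioo 0 (π / 2)) :=
    injOn_cos.mono fun _ hx => Set.Ioo_subset_Icc_self (hsub hx)
  have himage : cos '' Set.Ioo 0 (π / 2) = Set.Ioo 0 1 := by
    ext y
    constructor
    · rintro ⟨x, hx, rfl⟩
      have hc : 0 < cos x := cos_pos_of_mem_Ioo ⟨by linarith [hx.1, pi_pos], hx.2⟩
      exact ⟨hc, by nlinarith [sin_sq_add_cos_sq x, sin_pos_of_mem_Ioo (hsub hx)]⟩
    · rintro ⟨hy1, hy2⟩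
      exact ⟨arccos y, ⟨arccos_pos.2 hy2, arccos_lt_pi_div_two.2 hy1⟩,
        cos_arccos (by linarith) hy2.le⟩
  rw [← himage, lintegral_image_eq_lintegral_abs_deriv_mul measurableSet_Ioo
    (fun x _ => (hasDerivAt_cos x).hasDerivWithinAt) hinj]
  refine setLIntegral_congr_fun measurableSet_Ioo fun x hx => ?_
  have hs := sin_pos_of_mem_Ioo (hsub hx)
  rw [← sin_sq, Real.sqrt_sq hs.le, abs_neg, abs_of_pos hs, ← mul_assoc,
    ← ENNReal.ofReal_mul hs.le, mul_one_div_cancel hs.ne', ENNReal.ofReal_one, one_mul]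

lemma lintegral_inv_sqrt_one_sub_mul_sin_sq {u : ℝ} (hu : u ≠ 0) (hu1 : |u| < 1) :
    ∫⁻ θ in Set.Ioo 0 (π / 2), ENNReal.ofReal (1 / √(1 - (1 - u ^ 2) * sin θ ^ 2)) =
      ∫⁻ a in Set.Ioo |u| 1,
        ENNReal.ofReal (1 / √(1 - a ^ 2)) * ENNReal.ofReal (1 / √(a ^ 2 - u ^ 2)) := by
  have hu0 : 0 < u ^ 2 := by positivity
  have hm : 0 < 1 - u ^ 2 := by rw [sub_pos, sq_lt_one_iff_abs_lt_one]; exact hu1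
  have hcos {x : ℝ} (hx : x ∈ Set.Ioo 0 (π / 2)) : 0 < cos x :=
    cos_pos_of_mem_Ioo ⟨by linarith [hx.1, pi_pos], hx.2⟩
  have hsin {x : ℝ} (hx : x ∈ Set.Ioo 0 (π / 2)) : 0 < sin x :=
    sin_pos_of_pos_of_lt_pi hx.1 (by linarith [hx.2, pi_pos])
  have hpos (x : ℝ) : 0 < 1 - (1 - u ^ 2) * sin x ^ 2 := by
    nlinarith [mul_nonneg hm.le (sq_nonneg (cos x)), sin_sq_add_cos_sq x]
  have hinj : Set.InjOn (fun θ => √(1 - (1 - u ^ 2) * sin θ ^ 2)) (Set.Ioo 0 (π / 2)) := by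
    intro x hx y hy h
    have h1 := (Real.sqrt_inj (hpos x).le (hpos y).le).1 h
    have h2 : sin x ^ 2 = sin y ^ 2 := mul_left_cancel₀ hm.ne' (by linarith)
    exact injOn_sin ⟨by linarith [hx.1, pi_pos], hx.2.le⟩ ⟨by linarith [hy.1, pi_pos], hy.2.le⟩
      ((pow_left_inj₀ (hsin hx).le (hsin hy).le two_ne_zero).1 h2)
  have himage : (fun θ => √(1 - (1 - u ^ 2) * sin θ ^ 2)) '' Set.Ioo 0 (π / 2) =
      Set.Ioo |u| 1 := by
    ext a
    constructor
    · rintro ⟨x, hx, rfl⟩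
      constructor
      · rw [← Real.sqrt_sq_eq_abs]
        refine Real.sqrt_lt_sqrt hu0.le ?_
        nlinarith [mul_pos hm (pow_pos (hcos hx) 2), sin_sq_add_cos_sq x]
      · simp only
        rw [Real.sqrt_lt' one_pos]
        nlinarith [mul_pos hm (pow_pos (hsin hx) 2)]
    · rintro ⟨h1, h2⟩
      have ha : 0 < a := (abs_nonneg u).trans_lt h1
      have hau : u ^ 2 < a ^ 2 := by rw [sq_lt_sq, abs_of_pos ha]; exact h1
      have ha1 : 0 < 1 - a ^ 2 := by nlinarith
      have hs1 : √((1 - a ^ 2) / (1 - u ^ 2)) < 1 := by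
        rw [Real.sqrt_lt' one_pos, one_pow, div_lt_one hm]
        linarith
      refine ⟨arcsin √((1 - a ^ 2) / (1 - u ^ 2)), ⟨arcsin_pos.2 (by positivity),
        arcsin_lt_pi_div_two.2 hs1⟩, ?_⟩
      simp only
      rw [sin_arcsin (by linarith [Real.sqrt_nonneg ((1 - a ^ 2) / (1 - u ^ 2))]) hs1.le,
        Real.sq_sqrt (by positivity), mul_div_cancel₀ _ hm.ne', sub_sub_cancel,
        Real.sqrt_sq ha.le]
  have hderiv (x : ℝ) (_ : x ∈ Set.Ioo 0 (π / 2)) :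
      HasDerivWithinAt (fun θ => √(1 - (1 - u ^ 2) * sin θ ^ 2))
        (-((1 - u ^ 2) * sin x * cos x / √(1 - (1 - u ^ 2) * sin x ^ 2)))
        (Set.Ioo 0 (π / 2)) x := by
    have h := (((((hasDerivAt_sin x).fun_pow 2).const_mul (1 - u ^ 2)).const_sub 1).sqrt
      (hpos x).ne').hasDerivWithinAt (s := Set.Ioo 0 (π / 2))
    refine h.congr_deriv ?_
    push_cast
    field_simp
  rw [← himage, lintegral_image_eq_lintegral_abs_deriv_mul measurableSet_Ioo hderiv hinj]
  refine setLIntegral_congr_fun measurableSet_Ioo fun x hx => ?_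
  have hs := hsin hx
  have hc := hcos hx
  have ha := Real.sqrt_pos.2 (hpos x)
  rw [← ENNReal.ofReal_mul (by positivity), ← ENNReal.ofReal_mul (by positivity)]
  congr 1
  have h1 : √(1 - √(1 - (1 - u ^ 2) * sin x ^ 2) ^ 2) = √(1 - u ^ 2) * sin x := by
    rw [Real.sq_sqrt (hpos x).le, sub_sub_cancel, Real.sqrt_mul hm.le, Real.sqrt_sq hs.le]
  have h2 : √(√(1 - (1 - u ^ 2) * sin x ^ 2) ^ 2 - u ^ 2) = √(1 - u ^ 2) * cos x := by
    rw [Real.sq_sqrt (hpos x).le, show 1 - (1 - u ^ 2) * sin x ^ 2 - u ^ 2 =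
      (1 - u ^ 2) * cos x ^ 2 by rw [cos_sq']; ring, Real.sqrt_mul hm.le, Real.sqrt_sq hc.le]
  rw [h1, h2, abs_neg, abs_of_pos (by positivity)]
  have h3 : √(1 - u ^ 2) ^ 2 = 1 - u ^ 2 := Real.sq_sqrt hm.le
  have h4 := Real.sqrt_pos.2 hm
  generalize √(1 - (1 - u ^ 2) * sin x ^ 2) = r at *
  field_simp
  exact h3

/-- Swapping the order of integration turns a weighted integral of complete elliptic integrals
into an integral of the weight over a product of intervals. -/
lemma lintegral_elliptic_mul {g : ℝ → ENNReal} (hg : Measurable g) :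
    ∫⁻ u in Set.Ioo (-1) 1,
        (∫⁻ θ in Set.Ioo 0 (π / 2), ENNReal.ofReal (1 / √(1 - (1 - u ^ 2) * sin θ ^ 2))) * g u =
      ∫⁻ α in Set.Ioo 0 (π / 2), ∫⁻ β in Set.Ioo 0 π, g (cos α * cos β) := by
  let w : ℝ → ℝ → ENNReal := fun u a =>
    ENNReal.ofReal (1 / √(1 - a ^ 2)) * (ENNReal.ofReal (1 / √(a ^ 2 - u ^ 2)) * g u)
  let R : Set (ℝ × ℝ) := {p | |p.1| < p.2 ∧ p.2 < 1}
  have hR : MeasurableSet R :=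
    (measurableSet_lt (by fun_prop) measurable_snd).inter
      (measurableSet_lt measurable_snd measurable_const)
  have hw : Measurable (R.indicator (Function.uncurry w)) := by
    refine Measurable.indicator ?_ hR
    simp only [w, Function.uncurry_def]
    fun_prop
  have hleft : ∫⁻ u in Set.Ioo (-1) 1, (∫⁻ θ in Set.Ioo 0 (π / 2),
        ENNReal.ofReal (1 / √(1 - (1 - u ^ 2) * sin θ ^ 2))) * g u =
      ∫⁻ u, ∫⁻ a, R.indicator (Function.uncurry w) (u, a) := by
    rw [← lintegral_indicator measurableSet_Ioo]
    refine lintegral_congr_ae ?_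
    filter_upwards [Measure.ae_ne volume (0 : ℝ)] with u hu
    by_cases hu1 : |u| < 1
    · rw [Set.indicator_of_mem (Set.mem_Ioo.2 (abs_lt.1 hu1)),
        lintegral_inv_sqrt_one_sub_mul_sin_sq hu hu1, ← lintegral_mul_const _ (by fun_prop),
        ← lintegral_indicator measurableSet_Ioo]
      refine lintegral_congr fun a => ?_
      by_cases h : |u| < a ∧ a < 1
      · rw [Set.indicator_of_mem (Set.mem_Ioo.2 h),
          Set.indicator_of_mem (show (u, a) ∈ R from h), mul_assoc]
        rfl
      · rw [Set.indicator_of_notMem (mt Set.mem_Ioo.1 h),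
          Set.indicator_of_notMem (show (u, a) ∉ R from h)]
    · rw [Set.indicator_of_notMem fun h : u ∈ Set.Ioo (-1) 1 => hu1 (abs_lt.2 h)]
      refine (lintegral_eq_zero_of_ae_eq_zero (Eventually.of_forall fun a => ?_)).symm
      exact Set.indicator_of_notMem (fun h : (u, a) ∈ R => hu1 (h.1.trans h.2)) _
  have hright : ∫⁻ a, ∫⁻ u, R.indicator (Function.uncurry w) (u, a) =
      ∫⁻ a in Set.Ioo 0 1, ENNReal.ofReal (1 / √(1 - a ^ 2)) *
        ∫⁻ β in Set.Ioo 0 π, g (a * cos β) := by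
    rw [← lintegral_indicator measurableSet_Ioo]
    refine lintegral_congr fun a => ?_
    by_cases ha : a ∈ Set.Ioo (0 : ℝ) 1
    · rw [Set.indicator_of_mem ha, ← lintegral_Ioo_neg_self_div_sqrt ha.1,
        ← lintegral_const_mul _ (by fun_prop), ← lintegral_indicator measurableSet_Ioo]
      refine lintegral_congr fun u => ?_
      by_cases h : |u| < a
      · rw [Set.indicator_of_mem (Set.mem_Ioo.2 (abs_lt.1 h)),
          Set.indicator_of_mem (show (u, a) ∈ R from ⟨h, ha.2⟩)]
        rfl
      · rw [Set.indicator_of_notMem fun h' : u ∈ Set.Ioo (-a) a => h (abs_lt.2 h'),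
          Set.indicator_of_notMem fun h' : (u, a) ∈ R => h h'.1]
    · rw [Set.indicator_of_notMem ha]
      refine lintegral_eq_zero_of_ae_eq_zero (Eventually.of_forall fun u => ?_)
      exact Set.indicator_of_notMem
        (fun h : (u, a) ∈ R => ha ⟨(abs_nonneg u).trans_lt h.1, h.2⟩) _
  rw [hleft, lintegral_lintegral_swap (f := fun u a => R.indicator (Function.uncurry w) (u, a))
      hw.aemeasurable, hright,
    lintegral_Ioo_zero_one_div_sqrt fun a => ∫⁻ β in Set.Ioo 0 π, g (a * cos β)]

lemma integral_elliptic_mul {g : ℝ → ℝ} (hg : Measurable g) (hg0 : ∀ u, 0 ≤ g u)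
    (hgc : Continuous fun p : ℝ × ℝ => g (cos p.1 * cos p.2)) :
    ∫ u in (-1 : ℝ)..1, (∫ θ in Set.Ioo 0 (π / 2), 1 / √(1 - (1 - u ^ 2) * sin θ ^ 2)) * g u =
      ∫ α in (0 : ℝ)..π / 2, ∫ β in (0 : ℝ)..π, g (cos α * cos β) := by
  have hmeas : StronglyMeasurable fun u : ℝ =>
      ∫ θ in Set.Ioo 0 (π / 2), 1 / √(1 - (1 - u ^ 2) * sin θ ^ 2) := by
    refine StronglyMeasurable.integral_prod_right' (f := fun p : ℝ × ℝ =>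
      1 / √(1 - (1 - p.1 ^ 2) * sin p.2 ^ 2)) ?_
    exact Measurable.stronglyMeasurable (by fun_prop)
  have hinner (α : ℝ) : ENNReal.ofReal (∫ β in (0 : ℝ)..π, g (cos α * cos β)) =
      ∫⁻ β in Set.Ioo 0 π, ENNReal.ofReal (g (cos α * cos β)) := by
    have hc : Continuous fun β => g (cos α * cos β) := hgc.comp (by fun_prop : Continuous (α, ·))
    rw [intervalIntegral.integral_of_le pi_pos.le, integral_Ioc_eq_integral_Ioo]
    exact ofReal_integral_eq_lintegral_ofReal
      (hc.integrableOn_Icc.mono_set Set.Ioo_subset_Icc_self)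
      (Eventually.of_forall fun _ => hg0 _)
  have houter : ENNReal.ofReal (∫ α in (0 : ℝ)..π / 2, ∫ β in (0 : ℝ)..π, g (cos α * cos β)) =
      ∫⁻ α in Set.Ioo 0 (π / 2), ∫⁻ β in Set.Ioo 0 π, ENNReal.ofReal (g (cos α * cos β)) := by
    have hc : Continuous fun α => ∫ β in (0 : ℝ)..π, g (cos α * cos β) :=
      intervalIntegral.continuous_parametric_intervalIntegral_of_continuous' hgc 0 π
    rw [intervalIntegral.integral_of_le (by positivity), integral_Ioc_eq_integral_Ioo,
      ofReal_integral_eq_lintegral_ofReal (hc.integrableOn_Icc.mono_set Set.Ioo_subset_Icc_self)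
        (Eventually.of_forall fun _ =>
          intervalIntegral.integral_nonneg pi_pos.le fun _ _ => hg0 _)]
    simp only [hinner]
  have hnonneg : 0 ≤ ∫ α in (0 : ℝ)..π / 2, ∫ β in (0 : ℝ)..π, g (cos α * cos β) :=
    intervalIntegral.integral_nonneg (by positivity) fun _ _ =>
      intervalIntegral.integral_nonneg pi_pos.le fun _ _ => hg0 _
  rw [intervalIntegral.integral_of_le (by norm_num), integral_Ioc_eq_integral_Ioo,
    integral_eq_lintegral_of_nonneg_ae
      (Eventually.of_forall fun u => mul_nonneg (integral_nonneg fun θ => by positivity) (hg0 u))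
      (hmeas.mul hg.stronglyMeasurable).aestronglyMeasurable,
    ← ENNReal.toReal_ofReal hnonneg, houter, ← lintegral_elliptic_mul hg.ennreal_ofReal]
  congr 1
  refine lintegral_congr_ae ?_
  filter_upwards [ae_restrict_mem measurableSet_Ioo,
    ae_restrict_of_ae (Measure.ae_ne volume (0 : ℝ))] with u hu hu0
  have hpos (x : ℝ) : 0 < 1 - (1 - u ^ 2) * sin x ^ 2 := by
    have h1 : 0 < u ^ 2 := by positivity
    have h2 : 0 < 1 - u ^ 2 := by nlinarith [hu.1, hu.2]
    nlinarith [mul_nonneg h2.le (sq_nonneg (cos x)), sin_sq_add_cos_sq x]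
  have hc : Continuous fun θ => 1 / √(1 - (1 - u ^ 2) * sin θ ^ 2) :=
    continuous_const.div (by fun_prop) fun x => (Real.sqrt_pos.2 (hpos x)).ne'
  rw [ENNReal.ofReal_mul (integral_nonneg fun θ => by positivity),
    ofReal_integral_eq_lintegral_ofReal (hc.integrableOn_Icc.mono_set Set.Ioo_subset_Icc_self)
      (Eventually.of_forall fun θ => by positivity)]

theorem stmt14 :
    ∫ x in (0:ℝ)..1, K (2 * Real.sqrt (x * (1 - x))) /
        Real.sqrt (9/8 + (1 - 2 * x) / Real.sqrt 2) =
      Real.Gamma (1/4) ^ 4 / (16 * Real.sqrt 2 * Real.pi) := by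
  have hsub := intervalIntegral.integral_comp_sub_mul (a := 0) (b := 1) (c := 2)
    (fun u => (∫ θ in Set.Ioo 0 (π / 2), 1 / √(1 - (1 - u ^ 2) * sin θ ^ 2)) *
      (1 / √(9 / 8 + u / √2))) two_ne_zero 1
  have hpos (p : ℝ × ℝ) : 0 < 9 / 8 + cos p.1 * cos p.2 / √2 := by
    have h1 : |cos p.1 * cos p.2| ≤ 1 := by
      rw [abs_mul]
      exact mul_le_one₀ (abs_cos_le_one _) (abs_nonneg _) (abs_cos_le_one _)
    have h2 : (1 : ℝ) ≤ √2 := Real.one_le_sqrt.2 one_le_two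
    have h3 : |cos p.1 * cos p.2 / √2| ≤ 1 := by
      rw [abs_div, abs_of_pos (by positivity : 0 < √2)]
      exact (div_le_one (by positivity)).2 (h1.trans h2)
    linarith [(abs_le.1 h3).1]
  rw [show (1 : ℝ) - 2 * 1 = -1 by norm_num, mul_zero, sub_zero,
    integral_elliptic_mul (g := fun u => 1 / √(9 / 8 + u / √2)) (by fun_prop)
      (fun u => by positivity)
      (continuous_const.div (by fun_prop) fun p => (Real.sqrt_pos.2 (hpos p)).ne'),
    integral_integral_inv_sqrt, smul_eq_mul] at hsub
  have hK (x : ℝ) (hx : x ∈ Set.uIcc 0 1) :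
      K (2 * √(x * (1 - x))) / √(9 / 8 + (1 - 2 * x) / √2) =
        (∫ θ in Set.Ioo 0 (π / 2), 1 / √(1 - (1 - (1 - 2 * x) ^ 2) * sin θ ^ 2)) *
          (1 / √(9 / 8 + (1 - 2 * x) / √2)) := by
    rw [Set.uIcc_of_le zero_le_one] at hx
    have h : (2 * √(x * (1 - x))) ^ 2 = 1 - (1 - 2 * x) ^ 2 := by
      rw [mul_pow, Real.sq_sqrt (mul_nonneg hx.1 (by linarith [hx.2]))]
      ring
    rw [K, h, mul_one_div]
  rw [intervalIntegral.integral_congr hK, hsub]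
  field_simp
  norm_num
end
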